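/- arXiv:2603.06033 — 6 statements merged into one kernel-verified Lean document; each statement's English description precedes it below -/
import Mathlib

section
/- Let g ≥ 2, set n = ⌊(g−1)/2⌋, and let a_1, …, a_n ∈ k be linearly independent over 𝔽_{p²}. Fix ε ∈ {0,1} and let J = {j ∈ ℤ : 1 ≤ j ≤ g−1, j ≡ ε (mod 2)}; assume J has exactly n elements. Then for every family (d_j)_{j∈J} of elements of k, the set of tuples (z_1, …, z_n) ∈ k^n satisfying ∑_{i=1}^n ((−1)^{g−1}·σ^j(a_i)·z_i + a_i·σ^j(z_i)) = d_j for all j ∈ J is finite, and its cardinality is exactly ∏_{j∈J} p^j. -/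
open Finset

open Polynomial in
/-- A nonzero solution `T` of the iterated recursion `b₀ = c₀ Tᵖ`, `bᵢ₊₁ = bᵢᵖ + cᵢ₊₁ Tᵖ`,
`b_r = T`. -/
theorem exists_ne_zero_frobenius_recursion {k : Type*} [Field k] [IsAlgClosed k] {p : ℕ}
    (hp : 2 ≤ p) (c : ℕ → k) (r : ℕ) (hc : ∃ l ≤ r, c l ≠ 0) :
    ∃ b : ℕ → k, b r ≠ 0 ∧ b 0 = c 0 * b r ^ p ∧
      ∀ i, b (i + 1) = b i ^ p + c (i + 1) * b r ^ p := by
  let Q : ℕ → k[X] := fun i => Nat.rec (C (c 0) * X ^ p) (fun i q => q ^ p + C (c (i + 1)) * X ^ p) i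
  have Q_zero : Q 0 = C (c 0) * X ^ p := rfl
  have Q_succ (i) : Q (i + 1) = Q i ^ p + C (c (i + 1)) * X ^ p := rfl
  have X_sq_dvd (i) : X ^ 2 ∣ Q i := by
    induction i with
    | zero => exact Dvd.dvd.mul_left (pow_dvd_pow _ hp) _
    | succ i ih =>
      exact dvd_add (ih.trans (dvd_pow_self _ (by lia))) (Dvd.dvd.mul_left (pow_dvd_pow _ hp) _)
  have coeff_eq_zero (i) (hi : Q i = 0) : ∀ l ≤ i, c l = 0 := by
    induction i with
    | zero =>
      intro l hl
      obtain rfl : l = 0 := by lia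
      simpa [Q_zero, show p ≠ 0 by lia] using hi
    | succ i ih =>
      have hcoeff : (Q i ^ p).coeff p = 0 := by
        have hdvd : X ^ (2 * p) ∣ Q i ^ p := by
          rw [pow_mul]
          exact pow_dvd_pow_of_dvd (X_sq_dvd i) p
        exact X_pow_dvd_iff.1 hdvd p (by lia)
      have hci : c (i + 1) = 0 := by
        have := congrArg (fun q => q.coeff p) hi
        simpa [Q_succ, hcoeff] using this
      have hQi : Q i = 0 := by
        rw [Q_succ, hci] at hi
        simpa [show p ≠ 0 by lia] using hi
      intro l hl
      rcases Nat.le_succ_iff.1 hl with h | rfl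
      · exact ih hQi l h
      · exact hci
  obtain ⟨R, hR⟩ := X_sq_dvd r
  have hR0 : R ≠ 0 := by
    rintro rfl
    obtain ⟨l, hl, hcl⟩ := hc
    exact hcl (coeff_eq_zero r (by simpa using hR) l hl)
  have hdeg : 0 < (X * R).degree := by
    rw [← natDegree_pos_iff_degree_pos, natDegree_X_mul hR0]
    lia
  obtain ⟨T, hT⟩ := IsAlgClosed.exists_root (X * R - C 1) (by
    rw [degree_sub_C hdeg]
    exact hdeg.ne')
  have hT1 : T * R.eval T = 1 := by simpa [sub_eq_zero] using hT
  have hQT : (Q r).eval T = T := by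
    rw [hR, eval_mul, eval_pow, eval_X]
    linear_combination T * hT1
  refine ⟨fun i => (Q i).eval T, ?_, ?_, fun i => ?_⟩
  · change (Q r).eval T ≠ 0
    rw [hQT]
    rintro rfl
    simp at hT1
  · simp only [hQT]
    simp [Q_zero]
  · simp only [hQT]
    simp [Q_succ]

/-- An injective Frobenius-semilinear endomorphism has a nonzero fixed vector. -/
theorem exists_ne_zero_frobenius_fixed {k : Type*} [Field k] [IsAlgClosed k] {p : ℕ}
    [Fact p.Prime] [CharP k p] {V : Type*} [AddCommGroup V] [Module k V] [FiniteDimensional k V]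
    [Nontrivial V] (φ : V →ₛₗ[frobenius k p] V) (hφ : Function.Injective φ) :
    ∃ v : V, v ≠ 0 ∧ φ v = v := by
  obtain ⟨v₀, hv₀⟩ := exists_ne (0 : V)
  let e : ℕ → V := fun i => φ^[i] v₀
  have e_succ (i) : e (i + 1) = φ (e i) := Function.iterate_succ_apply' φ i v₀
  have e_ne (i) : e i ≠ 0 := by
    induction i with
    | zero => exact hv₀
    | succ i ih => rwa [e_succ, Ne, map_eq_zero_iff φ hφ]
  let S : ℕ →o Submodule k V :=
    ⟨fun m => Submodule.span k (e '' Set.Iio m), fun m m' h =>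
      Submodule.span_mono (Set.image_mono (Set.Iio_subset_Iio h))⟩
  have S_apply (m) : S m = Submodule.span k (e '' Set.Iio m) := rfl
  have hS : ∃ m, e m ∈ S m := by
    obtain ⟨m, hm⟩ := monotone_stabilizes_iff_noetherian.2 (inferInstance : IsNoetherian k V) S
    refine ⟨m, ?_⟩
    rw [hm (m + 1) (Nat.le_succ m)]
    exact Submodule.subset_span ⟨m, Nat.lt_succ_self m, rfl⟩
  classical
  obtain ⟨m, hm, hmin⟩ : ∃ m, e m ∈ S m ∧ ∀ l < m, e l ∉ S l :=
    ⟨Nat.find hS, Nat.find_spec hS, fun l hl => Nat.find_min hS hl⟩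
  obtain _ | r := m
  · have hS0 : S 0 = ⊥ := by simp [S_apply]
    rw [hS0, Submodule.mem_bot] at hm
    exact absurd hm (e_ne 0)
  obtain ⟨c, hc⟩ : ∃ c : ℕ → k, ∑ i ∈ range (r + 1), c i • e i = e (r + 1) := by
    rw [← Submodule.mem_span_image_finset_iff_exists_fun', coe_range]
    exact hm
  have hc0 : ∃ l ≤ r, c l ≠ 0 := by
    by_contra! h
    refine e_ne (r + 1) (hc.symm.trans (sum_eq_zero fun i hi => ?_))
    rw [h i (by simpa [Nat.lt_succ_iff] using hi), zero_smul]
  obtain ⟨b, hbr, hb0, hb⟩ :=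
    exists_ne_zero_frobenius_recursion (Fact.out : p.Prime).two_le c r hc0
  refine ⟨∑ i ∈ range (r + 1), b i • e i, fun h => ?_, ?_⟩
  · apply hmin r (Nat.lt_succ_self r)
    rw [sum_range_succ, add_eq_zero_iff_neg_eq] at h
    have hmem : b r • e r ∈ S r := by
      rw [← h]
      exact neg_mem (sum_mem fun i hi => Submodule.smul_mem _ _
        (Submodule.subset_span ⟨i, by simpa using hi, rfl⟩))
    exact (Submodule.smul_mem_iff _ hbr).1 hmem
  · have hφb : φ (∑ i ∈ range (r + 1), b i • e i) = ∑ i ∈ range (r + 1), b i ^ p • e (i + 1) := by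
      simp [map_sum, map_smulₛₗ, frobenius_def, e_succ]
    rw [hφb, sum_range_succ, ← hc, smul_sum, sum_range_succ', sum_range_succ' (fun i => b i • e i),
      ← add_assoc, ← sum_add_distrib]
    congr 1
    · refine sum_congr rfl fun i _ => ?_
      rw [hb, smul_smul, ← add_smul, mul_comm (c (i + 1))]
    · rw [hb0, smul_smul, mul_comm]

open Polynomial in
theorem card_pow_eq_self {k : Type*} [Field k] [IsAlgClosed k] (p : ℕ) [hp : Fact p.Prime]
    [CharP k p] : Nat.card {t : k // t ^ p = t} = p := by
  have hne : (X ^ p - X : k[X]) ≠ 0 := FiniteField.X_pow_card_sub_X_ne_zero k hp.out.one_lt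
  have hcard := card_rootSet_eq_natDegree (K := k) (galois_poly_separable (K := k) p p dvd_rfl)
    (IsAlgClosed.splits _)
  rw [FiniteField.X_pow_card_sub_X_natDegree_eq k hp.out.one_lt] at hcard
  rw [← Nat.card_eq_fintype_card] at hcard
  refine (Nat.card_congr (Equiv.subtypeEquivRight fun t => ?_)).trans hcard
  simp [mem_rootSet, hne, sub_eq_zero]

/-- **Lang's theorem** for Frobenius-semilinear endomorphisms: if `φ` is injective, then `φ - 1` is
surjective and its kernel has `p ^ dim V` elements. -/
theorem frobenius_sub_surjective_and_card_fixed {k : Type*} [Field k] [IsAlgClosed k] {p : ℕ}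
    [hp : Fact p.Prime] [CharP k p] {V : Type*} [AddCommGroup V] [Module k V]
    [FiniteDimensional k V] (φ : V →ₛₗ[frobenius k p] V) (hφ : Function.Injective φ) :
    (∀ y, ∃ x, φ x - x = y) ∧ Nat.card {x // φ x = x} = p ^ Module.finrank k V := by
  induction hd : Module.finrank k V generalizing V with
  | zero =>
    have : Subsingleton V := Module.finrank_zero_iff.1 hd
    refine ⟨fun y => ⟨0, Subsingleton.elim _ _⟩, ?_⟩
    have : Unique {x // φ x = x} := ⟨⟨⟨0, map_zero φ⟩⟩, fun _ => Subsingleton.elim _ _⟩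
    simp
  | succ d ih =>
    have : Nontrivial V := Module.nontrivial_of_finrank_pos (R := k) (by lia)
    obtain ⟨v, hv0, hv⟩ := exists_ne_zero_frobenius_fixed φ hφ
    have φ_smul (t : k) : φ (t • v) = t ^ p • v := by rw [map_smulₛₗ, hv, frobenius_def]
    let W := Submodule.span k {v}
    have hW : W ≤ W.comap φ := by
      rw [Submodule.span_singleton_le_iff_mem, Submodule.mem_comap, hv]
      exact Submodule.mem_span_singleton_self v
    have hdim : Module.finrank k (V ⧸ W) = d := by
      have h1 := W.finrank_quotient_add_finrank
      have h2 : Module.finrank k W = 1 := finrank_span_singleton hv0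
      lia
    have hinj : Function.Injective (W.mapQ W φ hW) := by
      rw [injective_iff_map_eq_zero]
      intro x hx
      obtain ⟨x, rfl⟩ := W.mkQ_surjective x
      obtain ⟨t, ht⟩ := Submodule.mem_span_singleton.1 ((Submodule.Quotient.mk_eq_zero W).1 hx)
      obtain ⟨s, rfl⟩ := IsAlgClosed.exists_pow_nat_eq t hp.out.pos
      rw [← φ_smul] at ht
      exact (Submodule.Quotient.mk_eq_zero W).2 (Submodule.mem_span_singleton.2 ⟨s, hφ ht⟩)
    obtain ⟨hsurj, hcard⟩ := ih (W.mapQ W φ hW) hinj hdim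
    have lift (y : V) (x : V ⧸ W) (hx : W.mapQ W φ hW x - x = W.mkQ y) :
        ∃ z, W.mkQ z = x ∧ φ z - z = y := by
      obtain ⟨x, rfl⟩ := W.mkQ_surjective x
      have hmem : φ x - x - y ∈ W := by
        rw [← Submodule.Quotient.mk_eq_zero, Submodule.Quotient.mk_sub, sub_eq_zero]
        exact hx
      obtain ⟨c, hc⟩ := Submodule.mem_span_singleton.1 hmem
      obtain ⟨t, ht⟩ : ∃ t : k, t ^ p - t = -c := by
        open Polynomial in
        have h1 : (X : k[X]).degree < (X ^ p : k[X]).degree := by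
          rw [degree_X_pow, degree_X]
          exact_mod_cast hp.out.one_lt
        have hdeg : (X ^ p - X : k[X]).degree = p := by
          rw [degree_sub_eq_left_of_degree_lt h1, degree_X_pow]
        have hpos : (0 : WithBot ℕ) < p := by exact_mod_cast hp.out.pos
        obtain ⟨t, ht⟩ := IsAlgClosed.exists_root (X ^ p - X - C (-c)) (by
          rw [degree_sub_C (hdeg ▸ hpos), hdeg]
          exact hpos.ne')
        exact ⟨t, by simpa [sub_eq_zero, add_eq_zero_iff_eq_neg] using ht⟩
      refine ⟨x + t • v, ?_, ?_⟩
      · have : W.mkQ (t • v) = 0 := by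
          rw [Submodule.mkQ_apply, Submodule.Quotient.mk_eq_zero]
          exact Submodule.mem_span_singleton.2 ⟨t, rfl⟩
        rw [map_add, this, add_zero]
      · have h3 : (t ^ p - t) • v = -(φ x - x - y) := by rw [ht, neg_smul, hc]
        rw [map_add, φ_smul, add_sub_add_comm, ← sub_smul, h3]
        abel
    refine ⟨fun y => ?_, ?_⟩
    · obtain ⟨x, hx⟩ := hsurj (W.mkQ y)
      obtain ⟨z, -, hz⟩ := lift y x hx
      exact ⟨z, hz⟩
    · choose s hs hs' using fun x : {x // W.mapQ W φ hW x = x} =>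
        lift 0 x.1 (by rw [x.2, sub_self, map_zero])
      have fixed_iff (x) (t : k) : φ (s x + t • v) = s x + t • v ↔ t ^ p = t := by
        rw [map_add, φ_smul, sub_eq_zero.1 (hs' x), add_right_inj, smul_left_inj hv0]
      have mk_add (x) (t : k) : W.mkQ (s x + t • v) = x.1 := by
        have : W.mkQ (t • v) = 0 := by
          rw [Submodule.mkQ_apply, Submodule.Quotient.mk_eq_zero]
          exact Submodule.mem_span_singleton.2 ⟨t, rfl⟩
        rw [map_add, this, add_zero, hs]
      let f : {x // W.mapQ W φ hW x = x} × {t : k // t ^ p = t} → {x // φ x = x} :=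
        fun q => ⟨s q.1 + q.2.1 • v, (fixed_iff _ _).2 q.2.2⟩
      have hf : Function.Bijective f := by
        refine ⟨fun q q' h => ?_, fun z => ?_⟩
        · have h' : s q.1 + q.2.1 • v = s q'.1 + q'.2.1 • v := congrArg Subtype.val h
          have h1 : q.1 = q'.1 := Subtype.ext (by rw [← mk_add q.1 q.2.1, h', mk_add])
          rw [h1, add_right_inj, smul_left_inj hv0] at h'
          exact Prod.ext h1 (Subtype.ext h')
        · let x : {x // W.mapQ W φ hW x = x} := ⟨W.mkQ z.1, congrArg W.mkQ z.2⟩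
          have hmem : z.1 - s x ∈ W := by
            rw [← Submodule.Quotient.mk_eq_zero, Submodule.Quotient.mk_sub, sub_eq_zero]
            exact (hs x).symm
          obtain ⟨t, ht⟩ := Submodule.mem_span_singleton.1 hmem
          have hz : s x + t • v = z.1 := by rw [ht, add_sub_cancel]
          exact ⟨(x, ⟨t, (fixed_iff x t).1 (by rw [hz, z.2])⟩), Subtype.ext hz⟩
      rw [← Nat.card_congr (Equiv.ofBijective f hf), Nat.card_prod, hcard, card_pow_eq_self, pow_succ]

theorem card_frobenius_sub_eq {k : Type*} [Field k] [IsAlgClosed k] {p : ℕ}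
    [Fact p.Prime] [CharP k p] {V : Type*} [AddCommGroup V] [Module k V]
    [FiniteDimensional k V] (φ : V →ₛₗ[frobenius k p] V) (hφ : Function.Injective φ) (y : V) :
    Nat.card {x // φ x - x = y} = p ^ Module.finrank k V := by
  obtain ⟨hsurj, hcard⟩ := frobenius_sub_surjective_and_card_fixed φ hφ
  obtain ⟨x₀, rfl⟩ := hsurj y
  rw [← hcard]
  refine Nat.card_congr ((Equiv.subRight x₀).subtypeEquiv fun x => ?_)
  rw [Equiv.subRight_apply, map_sub, sub_eq_sub_iff_sub_eq_sub]

/-- The system `uⱼ = dⱼ + (G u)ⱼ ^ (p ^ (mⱼ + 1))` becomes Frobenius-semilinear in the variables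
`(G u)ⱼ ^ (p ^ (t + 1))`, `0 ≤ t ≤ mⱼ`. -/
theorem card_eq_add_pow_prime_pow {k : Type*} [Field k] [IsAlgClosed k] {p : ℕ}
    [hp : Fact p.Prime] [CharP k p] {ι : Type*} [Fintype ι] (m : ι → ℕ)
    (G : (ι → k) →ₗ[k] (ι → k)) (hG : Function.Injective G) (d : ι → k) :
    Nat.card {u : ι → k // ∀ j, u j = d j + G u j ^ p ^ (m j + 1)} = ∏ j, p ^ (m j + 1) := by
  let last : ((j : ι) → Fin (m j + 1) → k) →ₗ[k] (ι → k) :=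
    LinearMap.pi fun j => LinearMap.proj (Fin.last (m j)) ∘ₗ LinearMap.proj j
  have last_apply (x j) : last x j = x j (Fin.last (m j)) := rfl
  let φ : ((j : ι) → Fin (m j + 1) → k) →ₛₗ[frobenius k p] ((j : ι) → Fin (m j + 1) → k) :=
    { toFun := fun x j => Fin.cons (G (last x) j ^ p) fun t : Fin (m j) => x j t.castSucc ^ p
      map_add' := fun x y => by
        ext j t
        cases t using Fin.cases <;> simp [add_pow_char]
      map_smul' := fun c x => by
        ext j t
        cases t using Fin.cases <;> simp [mul_pow, frobenius_def] }
  have φ_zero (x j) : φ x j 0 = G (last x) j ^ p := rfl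
  have φ_succ (x j) (t : Fin (m j)) : φ x j t.succ = x j t.castSucc ^ p := rfl
  have hp0 : p ≠ 0 := hp.out.ne_zero
  have hφ : Function.Injective φ := by
    rw [injective_iff_map_eq_zero]
    intro x hx
    have hlast : last x = 0 := by
      rw [← map_eq_zero_iff G hG]
      ext j
      have := congrFun (congrFun hx j) 0
      rw [φ_zero] at this
      exact (pow_eq_zero_iff hp0).1 this
    ext j t
    cases t using Fin.lastCases with
    | last => exact congrFun hlast j
    | cast t =>
      have := congrFun (congrFun hx j) t.succ
      rw [φ_succ] at this
      exact (pow_eq_zero_iff hp0).1 this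
  let y : (j : ι) → Fin (m j + 1) → k := fun j => Fin.cons (-(G d j ^ p)) fun _ => 0
  have sol_iff (x) : φ x - x = y ↔
      ∀ j, ∀ t : Fin (m j + 1), x j t = G (d + last x) j ^ p ^ (t.1 + 1) := by
    constructor
    · intro h j t
      have hz := congrFun (congrFun h j) 0
      have hs (t : Fin (m j)) := congrFun (congrFun h j) t.succ
      simp only [Pi.sub_apply, φ_zero, φ_succ, y, Fin.cons_zero, Fin.cons_succ] at hz hs
      induction t using Fin.induction with
      | zero =>
        rw [Fin.val_zero, zero_add, pow_one, map_add, Pi.add_apply, add_pow_char]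
        linear_combination -hz
      | succ t ih =>
        rw [← sub_eq_zero.1 (hs t), ih, ← pow_mul, ← pow_succ, Fin.val_succ, Fin.val_castSucc]
    · intro h
      ext j t
      rw [Pi.sub_apply, Pi.sub_apply]
      cases t using Fin.cases with
      | zero =>
        rw [h j 0, φ_zero, Fin.val_zero, zero_add, pow_one, map_add, Pi.add_apply, add_pow_char]
        simp [y]
      | succ t =>
        rw [φ_succ, h j t.castSucc, h j t.succ, ← pow_mul, ← pow_succ, Fin.val_succ,
          Fin.val_castSucc, sub_self]
        rfl
  have hfin : Module.finrank k ((j : ι) → Fin (m j + 1) → k) = ∑ j, (m j + 1) := by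
    rw [Module.finrank_pi_fintype]
    simp
  rw [prod_pow_eq_pow_sum, ← hfin, ← card_frobenius_sub_eq φ hφ y]
  refine Nat.card_congr
    { toFun := fun u => ⟨fun j t => G u.1 j ^ p ^ (t.1 + 1), ?_⟩
      invFun := fun x => ⟨d + last x.1, ?_⟩
      left_inv := fun u => ?_
      right_inv := fun x => ?_ }
  · have hu : d + last (fun j t => G u.1 j ^ p ^ (t.1 + 1)) = u.1 := by
      ext j
      rw [Pi.add_apply, last_apply, Fin.val_last, ← u.2 j]
    rw [sol_iff, hu]
    exact fun _ _ => rfl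
  · intro j
    rw [Pi.add_apply, last_apply, (sol_iff _).1 x.2 j (Fin.last _), Fin.val_last]
  · ext j
    simp only [Pi.add_apply, last_apply, Fin.val_last]
    exact (u.2 j).symm
  · ext j t
    exact ((sol_iff _).1 x.2 j t).symm

/-- Nonvanishing of the Moore determinant: a family that is linearly independent over the fixed
field of `τ` has linearly independent columns `(τ^t aᵢ)_{t < n}`. -/
theorem eq_zero_of_sum_mul_ringAut_pow {k : Type*} [Field k] (τ : RingAut k) {n : ℕ} (a : Fin n → k)
    (ha : ∀ c : Fin n → k, (∀ i, τ (c i) = c i) → ∑ i, c i * a i = 0 → ∀ i, c i = 0)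
    (z : Fin n → k) (hz : ∀ t < n, ∑ i, z i * (τ ^ t) (a i) = 0) : z = 0 := by
  induction n with
  | zero => exact Subsingleton.elim _ _
  | succ n ih =>
    have ha' (c : Fin n → k) (hc : ∀ i, τ (c i) = c i) (h : ∑ i, c i * a i.castSucc = 0) :
        ∀ i, c i = 0 := by
      intro i
      have := ha (Fin.snoc c 0)
        (fun i => by cases i using Fin.lastCases <;> simp [hc])
        (by simpa [Fin.sum_univ_castSucc] using h) i.castSucc
      simpa using this
    by_cases hlast : z (Fin.last n) = 0
    · have h0 := ih (fun i => a i.castSucc) ha' (fun i => z i.castSucc) fun t ht => by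
        simpa [Fin.sum_univ_castSucc, hlast] using hz t (by lia)
      ext i
      cases i using Fin.lastCases with
      | last => exact hlast
      | cast i => exact congrFun h0 i
    · exfalso
      let w : Fin (n + 1) → k := fun i => z i / z (Fin.last n)
      have hwlast : w (Fin.last n) = 1 := div_self hlast
      have hw (t) (ht : t < n + 1) : ∑ i, w i * (τ ^ t) (a i) = 0 := by
        have : ∑ i, w i * (τ ^ t) (a i) = (∑ i, z i * (τ ^ t) (a i)) / z (Fin.last n) := by
          rw [sum_div]
          exact sum_congr rfl fun i _ => by simp only [w, div_mul_eq_mul_div]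
        rw [this, hz t ht, zero_div]
      have hw' (t) (ht : t < n) : ∑ i, τ⁻¹ (w i) * (τ ^ t) (a i) = 0 := by
        have := congrArg (τ⁻¹ : RingAut k) (hw (t + 1) (by lia))
        rw [map_sum, map_zero] at this
        rw [← this]
        refine sum_congr rfl fun i _ => ?_
        rw [map_mul, pow_succ', ← RingAut.mul_apply τ⁻¹ (τ * τ ^ t), inv_mul_cancel_left]
      have h0 := ih (fun i => a i.castSucc) ha' (fun i => w i.castSucc - τ⁻¹ (w i.castSucc))
        fun t ht => by
          have h1 := hw t (by lia)
          have h2 := hw' t ht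
          rw [Fin.sum_univ_castSucc, hwlast] at h1 h2
          rw [map_one] at h2
          simp only [sub_mul, sum_sub_distrib]
          linear_combination h1 - h2
      have hfix (i) : τ (w i) = w i := by
        cases i using Fin.lastCases with
        | last => rw [hwlast, map_one]
        | cast i =>
          have := sub_eq_zero.1 (congrFun h0 i)
          conv_lhs => rw [this]
          exact RingEquiv.apply_symm_apply _ _
      have := ha w hfix (by simpa using hw 0 (by lia)) (Fin.last n)
      rw [hwlast] at this
      exact one_ne_zero this

theorem frobeniusEquiv_ringAut_pow_apply {k : Type*} [Field k] {p : ℕ} [Fact p.Prime]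
    [CharP k p] [PerfectRing k p] (j : ℕ) (x : k) :
    ((frobeniusEquiv k p : RingAut k) ^ j) x = x ^ p ^ j := by
  induction j with
  | zero => simp
  | succ j ih => rw [pow_succ', RingAut.mul_apply, ih, frobeniusEquiv_def, ← pow_mul, pow_succ]

/-- Let `g ≥ 2`, `n = ⌊(g−1)/2⌋`, and let `a_1, …, a_n ∈ k` be linearly
independent over `𝔽_{p²}`. Fix `ε ∈ {0,1}` and let
`J = {j : 1 ≤ j ≤ g−1, j ≡ ε (mod 2)}`; assume `J` has exactly `n` elements. Then for
every family `(d_j)_{j ∈ J}` in `k`, the set of tuples `(z_1, …, z_n) ∈ k^n` with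
`∑_i ((−1)^(g−1)·σ^j(a_i)·z_i + a_i·σ^j(z_i)) = d_j` for all `j ∈ J` is finite of
cardinality exactly `∏_{j ∈ J} p^j`. -/
theorem stmt1 (p : ℕ) [Fact p.Prime] (k : Type*) [Field k] [IsAlgClosed k] [CharP k p]
    (g : ℕ) (hg : 2 ≤ g) (n : ℕ) (hn : n = (g - 1) / 2) (a : Fin n → k)
    (ha : ∀ c : Fin n → k, (∀ i, c i ^ p ^ 2 = c i) → ∑ i, c i * a i = 0 → ∀ i, c i = 0)
    (ε : ℕ) (hε : ε = 0 ∨ ε = 1)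
    (J : Finset ℕ) (hJ : J = (Finset.Icc 1 (g - 1)).filter fun j => j % 2 = ε % 2)
    (hJcard : J.card = n) (d : ℕ → k) :
    (Set.Finite {z : Fin n → k | ∀ j ∈ J, ∑ i,
        ((-1 : k) ^ (g - 1) * ((frobeniusEquiv k p : RingAut k) ^ j) (a i) * z i
          + a i * ((frobeniusEquiv k p : RingAut k) ^ j) (z i)) = d j}) ∧
    {z : Fin n → k | ∀ j ∈ J, ∑ i,
        ((-1 : k) ^ (g - 1) * ((frobeniusEquiv k p : RingAut k) ^ j) (a i) * z i
          + a i * ((frobeniusEquiv k p : RingAut k) ^ j) (z i)) = d j}.ncard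
      = ∏ j ∈ J, p ^ j := by
  set σ : RingAut k := frobeniusEquiv k p
  have σ_pow (j : ℕ) (x : k) : (σ ^ j) x = x ^ p ^ j := frobeniusEquiv_ringAut_pow_apply j x
  obtain ⟨j₀, hmem⟩ : ∃ j₀, ∀ t < n, j₀ + 2 * t ∈ J := by
    rcases hε with rfl | rfl
    · exact ⟨2, fun t ht => by rw [hJ, mem_filter, mem_Icc]; lia⟩
    · exact ⟨1, fun t ht => by rw [hJ, mem_filter, mem_Icc]; lia⟩
  have one_le (j : J) : 1 ≤ j.1 := by
    obtain ⟨j, hj⟩ := j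
    rw [hJ, mem_filter, mem_Icc] at hj
    exact hj.1.1
  have ha_fixed (c : Fin n → k) (hc : ∀ i, (σ ^ 2) (c i) = c i) (h : ∑ i, c i * a i = 0) :
      ∀ i, c i = 0 := ha c (fun i => by rw [← σ_pow]; exact hc i) h
  have ha_fixed_inv (c : Fin n → k) (hc : ∀ i, (σ ^ 2)⁻¹ (c i) = c i) (h : ∑ i, c i * a i = 0) :
      ∀ i, c i = 0 :=
    ha_fixed c (fun i => by
      conv_lhs => rw [← hc i]
      exact RingEquiv.apply_symm_apply _ _) h
  let M : (Fin n → k) →ₗ[k] (J → k) :=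
    LinearMap.pi fun j => ∑ i, ((σ ^ j.1)⁻¹ (a i)) • LinearMap.proj i
  have M_apply (z j) : M z j = ∑ i, (σ ^ j.1)⁻¹ (a i) * z i := by simp [M]
  let N : (Fin n → k) →ₗ[k] (J → k) :=
    LinearMap.pi fun j => ∑ i, ((-1) ^ (g - 1) * (σ ^ j.1) (a i)) • LinearMap.proj i
  have N_apply (z j) : N z j = ∑ i, (-1) ^ (g - 1) * (σ ^ j.1) (a i) * z i := by simp [N]
  have hM : Function.Injective M := by
    rw [injective_iff_map_eq_zero]
    intro z hz
    have h0 := eq_zero_of_sum_mul_ringAut_pow (σ ^ 2)⁻¹ a ha_fixed_inv (fun i => (σ ^ j₀) (z i))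
      fun t ht => by
        have := congrArg (σ ^ j₀ : RingAut k) (congrFun hz ⟨_, hmem t ht⟩)
        rw [M_apply, Pi.zero_apply, map_sum, map_zero] at this
        rw [← this]
        refine sum_congr rfl fun i _ => ?_
        rw [map_mul, ← RingAut.mul_apply, mul_comm]
        congr 2
        group
    ext i
    exact (map_eq_zero_iff _ (σ ^ j₀ : RingAut k).injective).1 (congrFun h0 i)
  have hN : Function.Injective N := by
    rw [injective_iff_map_eq_zero]
    intro z hz
    have h0 := eq_zero_of_sum_mul_ringAut_pow (σ ^ 2) a ha_fixed (fun i => (σ ^ j₀)⁻¹ (z i))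
      fun t ht => by
        have h1 := congrFun hz ⟨_, hmem t ht⟩
        rw [N_apply, Pi.zero_apply] at h1
        simp only [mul_assoc] at h1
        rw [← mul_sum] at h1
        have := congrArg ((σ ^ j₀)⁻¹ : RingAut k)
          ((mul_eq_zero.1 h1).resolve_left (pow_ne_zero _ (neg_ne_zero.2 one_ne_zero)))
        rw [map_sum, map_zero] at this
        rw [← this]
        refine sum_congr rfl fun i _ => ?_
        rw [map_mul, ← RingAut.mul_apply, mul_comm]
        congr 2
        group
    ext i
    exact (map_eq_zero_iff _ ((σ ^ j₀)⁻¹ : RingAut k).injective).1 (congrFun h0 i)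
  let E : (Fin n → k) ≃ₗ[k] (J → k) := LinearEquiv.ofInjectiveOfFinrankEq N hN (by simp [hJcard])
  have E_apply (z) : E z = N z := rfl
  let G : (J → k) →ₗ[k] (J → k) := -(M ∘ₗ E.symm.toLinearMap)
  have hG : Function.Injective G := fun u v h =>
    E.symm.injective (hM (neg_injective h))
  have hcount := card_eq_add_pow_prime_pow (p := p) (fun j : J => j.1 - 1) G hG (fun j => d j)
  simp only [Nat.sub_add_cancel (one_le _)] at hcount
  rw [prod_coe_sort J fun j => p ^ j] at hcount
  have hcard : {z : Fin n → k | ∀ j ∈ J, ∑ i,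
      ((-1 : k) ^ (g - 1) * (σ ^ j) (a i) * z i + a i * (σ ^ j) (z i)) = d j}.ncard
        = ∏ j ∈ J, p ^ j := by
    rw [← hcount, ← Nat.card_coe_set_eq]
    refine Nat.card_congr (E.toEquiv.subtypeEquiv fun z => ?_)
    refine Iff.trans ?_ Subtype.forall.symm
    refine forall₂_congr fun j hj => ?_
    have hGE : G (E z) ⟨j, hj⟩ ^ p ^ j = -∑ i, a i * (σ ^ j) (z i) := by
      have : G (E z) = -M z := by simp [G]
      rw [this, Pi.neg_apply, ← σ_pow, map_neg, M_apply, map_sum]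
      congr 1
      refine sum_congr rfl fun i _ => ?_
      rw [map_mul, RingAut.inv_apply, RingEquiv.apply_symm_apply]
    change _ ↔ E z ⟨j, hj⟩ = d j + G (E z) ⟨j, hj⟩ ^ p ^ j
    rw [hGE, E_apply, N_apply, sum_add_distrib, ← sub_eq_add_neg, eq_sub_iff_add_eq]
  refine ⟨Set.finite_of_ncard_ne_zero ?_, hcard⟩
  rw [hcard]
  exact (prod_pos fun j _ => pow_pos (Fact.out : p.Prime).pos j).ne'
end

section
/- Let g ≥ 2, set n = ⌊(g−1)/2⌋, and let a_1, …, a_n ∈ k be linearly independent over 𝔽_{p²}. Fix ε ∈ {0,1} and let J = {j ∈ ℤ : 1 ≤ j ≤ g−1, j ≡ ε (mod 2)}; assume J has exactly n elements. If (z_1, …, z_n) ∈ k^n satisfies ∑__{i=1}^n a_i·σ^j(z_i) = 0 for all j ∈ J, then z_1 = ⋯ = z_n = 0. -/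
open Finset

/-- If `a` is linearly independent over the fixed field of `τ` and the `n` twisted relations
`∑ i, a i * τ ^ m (w i) = 0`, `m < n`, hold, then `w` vanishes. -/
theorem eq_zero_of_sum_mul_ringAut_pow_eq_zero {K : Type*} [Field K] (τ : RingAut K) {n : ℕ}
    (a w : Fin n → K)
    (ha : ∀ c : Fin n → K, (∀ i, τ (c i) = c i) → ∑ i, c i * a i = 0 → ∀ i, c i = 0)
    (hw : ∀ m < n, ∑ i, a i * (τ ^ m) (w i) = 0) : ∀ i, w i = 0 := by
  induction n with
  | zero => exact fun i => i.elim0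
  | succ n ih =>
    have ha' : ∀ c : Fin n → K, (∀ i, τ (c i) = c i) →
        ∑ i, c i * a i.castSucc = 0 → ∀ i, c i = 0 := by
      intro c hc hsum i
      have := ha (Fin.snoc c 0) (fun j => by refine Fin.lastCases ?_ (fun j => ?_) j <;> simp [hc])
        (by simpa [Fin.sum_univ_castSucc] using hsum) i.castSucc
      simpa using this
    have hlast : w (Fin.last n) = 0 := by
      by_contra hne
      set u : Fin (n + 1) → K := fun i => w i / w (Fin.last n) with hu
      have hulast : u (Fin.last n) = 1 := div_self hne
      have hrel : ∀ m < n + 1, ∑ i, a i * (τ ^ m) (u i) = 0 := by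
        intro m hm
        simp only [hu, map_div₀, ← mul_div_assoc, ← Finset.sum_div, hw m hm, zero_div]
      have hfix := ih (fun i => a i.castSucc) (fun i => τ (u i.castSucc) - u i.castSucc) ha' (by
        intro m hm
        have h1 := hrel (m + 1) (by lia)
        have h0 := hrel m (by lia)
        rw [Fin.sum_univ_castSucc, hulast, map_one] at h0 h1
        simp only [pow_succ, RingAut.mul_apply] at h1
        simp only [map_sub, mul_sub, Finset.sum_sub_distrib]
        linear_combination h1 - h0)
      have hu0 := ha u
        (fun i => Fin.lastCases (by rw [hulast, map_one]) (fun j => sub_eq_zero.mp (hfix j)) i)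
        (by simpa [mul_comm] using hrel 0 (by lia)) (Fin.last n)
      exact one_ne_zero (hulast.symm.trans hu0)
    have hinit := ih (fun i => a i.castSucc) (fun i => w i.castSucc) ha' (fun m hm => by
      simpa [Fin.sum_univ_castSucc, hlast] using hw m (by lia))
    exact fun i => Fin.lastCases hlast hinit i

/-- Let `g ≥ 2`, `n = ⌊(g−1)/2⌋`, and let `a_1, …, a_n ∈ k` be linearly
independent over `𝔽_{p²}`. Fix `ε ∈ {0,1}` and let
`J = {j : 1 ≤ j ≤ g−1, j ≡ ε (mod 2)}`; assume `J` has exactly `n` elements. If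
`(z_1, …, z_n) ∈ k^n` satisfies `∑_i a_i·σ^j(z_i) = 0` for all `j ∈ J`, then all
`z_i` vanish. -/
theorem stmt2 (p : ℕ) [Fact p.Prime] (k : Type*) [Field k] [IsAlgClosed k] [CharP k p]
    (g : ℕ) (hg : 2 ≤ g) (n : ℕ) (hn : n = (g - 1) / 2) (a : Fin n → k)
    (ha : ∀ c : Fin n → k, (∀ i, c i ^ p ^ 2 = c i) → ∑ i, c i * a i = 0 → ∀ i, c i = 0)
    (ε : ℕ) (hε : ε = 0 ∨ ε = 1)
    (J : Finset ℕ) (hJ : J = (Finset.Icc 1 (g - 1)).filter fun j => j % 2 = ε % 2)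
    (hJcard : J.card = n)
    (z : Fin n → k)
    (hz : ∀ j ∈ J, ∑ i, a i * ((frobeniusEquiv k p : RingAut k) ^ j) (z i) = 0) :
    ∀ i, z i = 0 := by
  have hw := eq_zero_of_sum_mul_ringAut_pow_eq_zero ((frobeniusEquiv k p : RingAut k) ^ 2) a
    (fun i => ((frobeniusEquiv k p : RingAut k) ^ (2 - ε)) (z i))
    (fun c hc => ha c fun i => by
      simpa [pow_two, RingAut.mul_apply, frobeniusEquiv_apply, frobenius_def, ← pow_mul]
        using hc i)
    (fun m hm => by
      have hmem : 2 * m + (2 - ε) ∈ J := by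
        rw [hJ, Finset.mem_filter, Finset.mem_Icc]
        lia
      simpa only [pow_add, pow_mul, RingAut.mul_apply] using hz _ hmem)
  exact fun i => (map_eq_zero_iff _ (RingEquiv.injective _)).mp (hw i)
end

section
/- Let g ≥ 2, set n = ⌊(g−1)/2⌋, let a_1, …, a_n ∈ k be linearly independent over 𝔽_{p²}, and let J = {j ∈ ℤ : 1 ≤ j ≤ g−1, j ≡ g (mod 2)} (this set has exactly n elements). Then the set of tuples (x_1, …, x_n) ∈ k^n satisfying ∑_{i=1}^n ((−1)^{g−1}·x_i·σ^j(a_i) + σ^j(x_i)·a_i) = 0 for all j ∈ J is exactly the set of tuples of the form x_i = b_{ii}·a_i + ∑_{l>i} b_{il}·a_l + (−1)^g·∑_{l<i} σ^g(b_{li})·a_l, where b_{il} ∈ 𝔽_{p²} for all i < l ≤ n, and b_{ii} ∈ 𝔽_{p²} if g is even while b_{ii} ∈ {b ∈ 𝔽_{p²} : σ(b) = −b} if g is odd; moreover, distinct choices of the parameters (b_{il})_{i≤l} give distinct tuples (x_1, …, x_n). -/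
open Polynomial in
/-- The fixed points of `x ↦ x ^ p ^ 2` form a set of `p ^ 2` elements. -/
lemma exists_finset_pow_eq_self (p : ℕ) [Fact p.Prime] (k : Type*) [Field k] [IsAlgClosed k]
    [CharP k p] : ∃ F : Finset k, F.card = p ^ 2 ∧ ∀ b, b ∈ F ↔ b ^ p ^ 2 = b := by
  classical
  have hp : 1 < p ^ 2 := Nat.one_lt_pow two_ne_zero (Fact.out : p.Prime).one_lt
  have hsep : (X ^ p ^ 2 - X : k[X]).Separable :=
    galois_poly_separable p (p ^ 2) (dvd_pow_self p two_ne_zero)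
  refine ⟨(X ^ p ^ 2 - X : k[X]).roots.toFinset, ?_, fun b => ?_⟩
  · rw [Multiset.toFinset_card_of_nodup (nodup_roots hsep),
      ← (IsAlgClosed.splits (X ^ p ^ 2 - X : k[X])).natDegree_eq_card_roots,
      FiniteField.X_pow_card_sub_X_natDegree_eq k hp]
  · rw [Multiset.mem_toFinset, mem_roots (FiniteField.X_pow_card_sub_X_ne_zero k hp)]
    simp [sub_eq_zero]

section

variable {p : ℕ} {k : Type*} [Field k] {n : ℕ} {a : Fin n → k}

lemma pow_prime_pow_two_mul {c : k} (hc : c ^ p ^ 2 = c) (j : ℕ) : c ^ p ^ (2 * j) = c := by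
  induction j with
  | zero => simp
  | succ j ih => rw [mul_add, mul_one, pow_add, pow_mul, ih, hc]

lemma pow_prime_pow_congr {c : k} (hc : c ^ p ^ 2 = c) {i j : ℕ} (h : i % 2 = j % 2) :
    c ^ p ^ i = c ^ p ^ j := by
  rw [← Nat.div_add_mod i 2, ← Nat.div_add_mod j 2, pow_add, pow_mul,
    pow_prime_pow_two_mul hc, pow_add, pow_mul, pow_prime_pow_two_mul hc, h]

lemma pow_prime_pow_fixed {c : k} (hc : c ^ p ^ 2 = c) (j : ℕ) :
    (c ^ p ^ j) ^ p ^ 2 = c ^ p ^ j := by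
  rw [← pow_mul, mul_comm, pow_mul, hc]

/-- `a` is linearly independent over the fixed points of `x ↦ x ^ p ^ 2`. -/
def FixedIndep (p : ℕ) (a : Fin n → k) : Prop :=
  ∀ c : Fin n → k, (∀ i, c i ^ p ^ 2 = c i) → ∑ i, c i * a i = 0 → ∀ i, c i = 0

open Polynomial in
/-- The additive polynomial `∑ c_j X ^ p ^ (2 j)`. -/
noncomputable def addPoly (p : ℕ) {m : ℕ} (c : Fin m → k) : k[X] :=
  ∑ j, C (c j) * X ^ p ^ (2 * (j : ℕ))

lemma addPoly_eval {m : ℕ} (c : Fin m → k) (x : k) :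
    (addPoly p c).eval x = ∑ j, c j * x ^ p ^ (2 * (j : ℕ)) := by
  simp [addPoly, Polynomial.eval_finsetSum]

/-- The square matrix determined by its upper triangular part through
`B i l = (-1) ^ g * (B l i) ^ p ^ g`. -/
def completeUpper (p g : ℕ) (b : Fin n → Fin n → k) (i l : Fin n) : k :=
  if i ≤ l then b i l else (-1) ^ g * b l i ^ p ^ g

lemma sum_completeUpper (g : ℕ) (b : Fin n → Fin n → k) (i : Fin n) :
    b i i * a i + ∑ l ∈ Finset.univ.filter (fun l => i < l), b i l * a l
      + (-1 : k) ^ g * ∑ l ∈ Finset.univ.filter (fun l => l < i), b l i ^ p ^ g * a l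
      = ∑ l, completeUpper p g b i l * a l := by
  rw [← Finset.sum_filter_add_sum_filter_not Finset.univ (fun l => i ≤ l)]
  have hge : Finset.univ.filter (fun l => i ≤ l)
      = insert i (Finset.univ.filter fun l => i < l) := by
    ext l
    simp [le_iff_eq_or_lt, eq_comm]
  congr 1
  · rw [hge, Finset.sum_insert (by simp)]
    refine congrArg₂ _ (by simp [completeUpper]) (Finset.sum_congr rfl fun l hl => ?_)
    rw [completeUpper, if_pos (Finset.mem_filter.1 hl).2.le]
  · rw [Finset.mul_sum]
    simp only [not_le]
    refine Finset.sum_congr rfl fun l hl => ?_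
    rw [completeUpper, if_neg (Finset.mem_filter.1 hl).2.not_ge, mul_assoc]

variable [Fact p.Prime]

lemma addPoly_ne_zero {m : ℕ} {c : Fin m → k} (hc : c ≠ 0) : addPoly p c ≠ 0 := by
  intro h
  refine hc (funext fun i => ?_)
  have hi := congrArg (fun P => Polynomial.coeff P (p ^ (2 * (i : ℕ)))) h
  simpa [addPoly, Polynomial.finsetSum_coeff, Polynomial.coeff_X_pow,
    (Nat.pow_right_injective (Fact.out : p.Prime).two_le).eq_iff, Fin.val_inj] using hi

lemma addPoly_natDegree_le {m : ℕ} (c : Fin (m + 1) → k) :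
    (addPoly p c).natDegree ≤ (p ^ 2) ^ m := by
  refine Polynomial.natDegree_sum_le_of_forall_le _ _ fun j _ => ?_
  refine (Polynomial.natDegree_C_mul_X_pow_le _ _).trans ?_
  rw [← pow_mul]
  exact Nat.pow_le_pow_right (Fact.out : p.Prime).pos (by omega)

variable [CharP k p]

lemma sum_pow_prime_pow {ι : Type*} (s : Finset ι) (f : ι → k) (j : ℕ) :
    (∑ i ∈ s, f i) ^ p ^ j = ∑ i ∈ s, f i ^ p ^ j := by
  simpa only [iterateFrobenius_def] using map_sum (iterateFrobenius k p j) f s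

lemma neg_one_pow_pow_prime_pow (g j : ℕ) : (((-1 : k) ^ g) ^ p ^ j) = (-1) ^ g := by
  rw [← iterateFrobenius_def, map_pow, map_neg, map_one]

lemma neg_one_pow_mul_fixed {c : k} (hc : c ^ p ^ 2 = c) (g : ℕ) :
    ((-1) ^ g * c) ^ p ^ 2 = (-1) ^ g * c := by
  rw [mul_pow, neg_one_pow_pow_prime_pow, hc]

lemma sub_fixed {c d : k} (hc : c ^ p ^ 2 = c) (hd : d ^ p ^ 2 = d) :
    (c - d) ^ p ^ 2 = c - d := by
  rw [sub_pow_char_pow, hc, hd]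

lemma FixedIndep.ext (ha : FixedIndep p a) {c d : Fin n → k} (hc : ∀ i, c i ^ p ^ 2 = c i)
    (hd : ∀ i, d i ^ p ^ 2 = d i) (h : ∑ i, c i * a i = ∑ i, d i * a i) : c = d := by
  funext i
  refine sub_eq_zero.1 (ha (fun i => c i - d i) (fun i => sub_fixed (hc i) (hd i)) ?_ i)
  simp only [sub_mul, Finset.sum_sub_distrib, h, sub_self]

lemma FixedIndep.pow (ha : FixedIndep p a) (r : ℕ) : FixedIndep p fun i => a i ^ p ^ r := by
  intro c hc h i
  have key : (∑ i, c i ^ p ^ r * a i) ^ p ^ r = 0 := by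
    rw [sum_pow_prime_pow, ← h]
    refine Finset.sum_congr rfl fun i _ => ?_
    rw [mul_pow, ← pow_mul, ← pow_add, ← two_mul, pow_prime_pow_two_mul (hc i)]
  have h0 := ha _ (fun i => pow_prime_pow_fixed (hc i) r) (eq_zero_of_pow_eq_zero key) i
  exact eq_zero_of_pow_eq_zero h0

open Polynomial in
/-- A nonzero polynomial vanishing on the span of `a` has degree at least `(p ^ 2) ^ n`, and in case
of equality the span is the set of all its roots. -/
lemma FixedIndep.degree_bound [IsAlgClosed k] (ha : FixedIndep p a) {P : k[X]} (hP : P ≠ 0)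
    (h : ∀ c : Fin n → k, (∀ i, c i ^ p ^ 2 = c i) → P.eval (∑ i, c i * a i) = 0) :
    (p ^ 2) ^ n ≤ P.natDegree ∧ (P.natDegree ≤ (p ^ 2) ^ n → ∀ x, P.eval x = 0 →
      ∃ c : Fin n → k, (∀ i, c i ^ p ^ 2 = c i) ∧ x = ∑ i, c i * a i) := by
  classical
  obtain ⟨F, hF, hmem⟩ := exists_finset_pow_eq_self p k
  let S : Finset k := (Fintype.piFinset fun _ : Fin n => F).image fun c => ∑ i, c i * a i
  have hS : S.card = (p ^ 2) ^ n := by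
    rw [Finset.card_image_of_injOn, Fintype.card_piFinset]
    · simp [hF]
    · intro c hc d hd hcd
      simp only [Finset.mem_coe, Fintype.mem_piFinset, hmem] at hc hd
      exact ha.ext hc hd hcd
  have hsub : S ⊆ P.roots.toFinset := by
    intro x hx
    obtain ⟨c, hc, rfl⟩ := Finset.mem_image.1 hx
    simp only [Fintype.mem_piFinset, hmem] at hc
    rw [Multiset.mem_toFinset, mem_roots hP]
    exact h c hc
  have hcard : P.roots.toFinset.card ≤ P.natDegree :=
    (Multiset.toFinset_card_le _).trans (card_roots' P)
  refine ⟨hS ▸ (Finset.card_le_card hsub).trans hcard, fun hdeg x hx => ?_⟩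
  have hxS : x ∈ S := by
    rw [Finset.eq_of_subset_of_card_le hsub (by omega), Multiset.mem_toFinset, mem_roots hP]
    exact hx
  obtain ⟨c, hc, rfl⟩ := Finset.mem_image.1 hxS
  simp only [Fintype.mem_piFinset, hmem] at hc
  exact ⟨c, hc, rfl⟩

lemma addPoly_eval_sum {m : ℕ} {c : Fin m → k}
    (hca : ∀ i, (addPoly p c).eval (a i) = 0) (d : Fin n → k) (hd : ∀ i, d i ^ p ^ 2 = d i) :
    (addPoly p c).eval (∑ i, d i * a i) = 0 := by
  simp only [addPoly_eval] at hca ⊢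
  calc ∑ j, c j * (∑ i, d i * a i) ^ p ^ (2 * (j : ℕ))
      = ∑ j, ∑ i, d i * (c j * a i ^ p ^ (2 * (j : ℕ))) := by
        refine Finset.sum_congr rfl fun j _ => ?_
        rw [sum_pow_prime_pow, Finset.mul_sum]
        refine Finset.sum_congr rfl fun i _ => ?_
        rw [mul_pow, pow_prime_pow_two_mul (hd i)]
        ring
    _ = 0 := by
        rw [Finset.sum_comm]
        simp [← Finset.mul_sum, hca]

/-- The Moore matrix of an independent family is nonsingular. -/
lemma FixedIndep.moore [IsAlgClosed k] (ha : FixedIndep p a) (r : ℕ) {y : Fin n → k}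
    (hy : ∀ j : Fin n, ∑ i, y i * a i ^ p ^ (r + 2 * (j : ℕ)) = 0) : y = 0 := by
  by_contra hne
  let M : Matrix (Fin n) (Fin n) k := fun j i => a i ^ p ^ (r + 2 * (j : ℕ))
  have hM : ∃ v, v ≠ 0 ∧ M.mulVec v = 0 :=
    ⟨y, hne, funext fun j => by simpa [M, Matrix.mulVec, dotProduct, mul_comm] using hy j⟩
  obtain ⟨v, hv, hvM⟩ :=
    Matrix.exists_vecMul_eq_zero_iff.2 (Matrix.exists_mulVec_eq_zero_iff.1 hM)
  have hroot (i : Fin n) : (addPoly p v).eval (a i ^ p ^ r) = 0 := by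
    rw [addPoly_eval]
    simpa only [M, Matrix.vecMul, dotProduct, pow_add, pow_mul, Pi.zero_apply] using congrFun hvM i
  cases n with
  | zero => exact hne (Subsingleton.elim _ _)
  | succ m =>
    have h1 := ((ha.pow r).degree_bound (addPoly_ne_zero hv) (addPoly_eval_sum hroot)).1
    have h2 := h1.trans (addPoly_natDegree_le v)
    have h3 : (p ^ 2) ^ m < (p ^ 2) ^ (m + 1) :=
      Nat.pow_lt_pow_right (Nat.one_lt_pow two_ne_zero (Fact.out : p.Prime).one_lt) m.lt_succ_self
    omega

/-- Relations between the Frobenius twists of `a` and `x` force `x` into the span of `a`. -/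
lemma FixedIndep.mem_span [IsAlgClosed k] (ha : FixedIndep p a) (r : ℕ) (e : k) {x : Fin n → k}
    (h : ∀ s ≤ n, ∀ t < n, ∑ i, x i ^ p ^ (2 * s) * a i ^ p ^ (r + 2 * t)
      = e * ∑ i, x i ^ p ^ (r + 2 * t) * a i ^ p ^ (2 * s)) :
    ∃ B : Fin n → Fin n → k, (∀ i l, B i l ^ p ^ 2 = B i l) ∧ ∀ i, x i = ∑ l, B i l * a l := by
  let M : Matrix (Fin n) (Fin (n + 1)) k := fun i j => a i ^ p ^ (2 * (j : ℕ))
  obtain ⟨c, hcM, hc⟩ : ∃ c, M.mulVec c = 0 ∧ c ≠ 0 := by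
    have hker : LinearMap.ker M.mulVecLin ≠ ⊥ :=
      LinearMap.ker_ne_bot_of_finrank_lt (by simp)
    obtain ⟨c, hc, hc0⟩ := (Submodule.ne_bot_iff _).1 hker
    exact ⟨c, hc, hc0⟩
  have hca (i : Fin n) : ∑ j, c j * a i ^ p ^ (2 * (j : ℕ)) = 0 := by
    simpa [M, Matrix.mulVec, dotProduct, mul_comm (c _)] using congrFun hcM i
  have hcx : (fun i => ∑ j, c j * x i ^ p ^ (2 * (j : ℕ))) = 0 := by
    refine ha.moore r fun t => ?_
    calc ∑ i, (∑ j, c j * x i ^ p ^ (2 * (j : ℕ))) * a i ^ p ^ (r + 2 * (t : ℕ))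
        = ∑ j, c j * ∑ i, x i ^ p ^ (2 * (j : ℕ)) * a i ^ p ^ (r + 2 * (t : ℕ)) := by
          simp only [Finset.sum_mul, Finset.mul_sum, mul_assoc]
          exact Finset.sum_comm
      _ = ∑ j, ∑ i, e * x i ^ p ^ (r + 2 * (t : ℕ)) * (c j * a i ^ p ^ (2 * (j : ℕ))) := by
          refine Finset.sum_congr rfl fun j _ => ?_
          rw [h j (by omega) t t.2, Finset.mul_sum, Finset.mul_sum]
          exact Finset.sum_congr rfl fun i _ => by ring
      _ = 0 := by
          rw [Finset.sum_comm]
          simp [← Finset.mul_sum, hca]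
  have hroot (i : Fin n) : (addPoly p c).eval (x i) = 0 := by
    rw [addPoly_eval]
    exact congrFun hcx i
  have hspan := (ha.degree_bound (addPoly_ne_zero hc)
    (addPoly_eval_sum fun i => by rw [addPoly_eval, hca i])).2 (addPoly_natDegree_le c)
  choose B hB hxB using fun i => hspan (x i) (hroot i)
  exact ⟨B, hB, hxB⟩

/-- With `ε = (-1) ^ g`, the relations for `j` propagate to all pairs of exponents differing
by `j`. -/
lemma twisted_relation {g : ℕ} {x : Fin n → k}
    (h : ∀ j, 1 ≤ j → j ≤ g - 1 → j % 2 = g % 2 →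
      ∑ i, x i ^ p ^ j * a i = (-1) ^ g * ∑ i, x i * a i ^ p ^ j)
    {s t : ℕ} (hst : s < t + g) (hts : t < s + g) (hpar : (s + t) % 2 = g % 2) :
    ∑ i, x i ^ p ^ s * a i ^ p ^ t = (-1) ^ g * ∑ i, x i ^ p ^ t * a i ^ p ^ s := by
  have key (u j : ℕ) (h1 : 1 ≤ j) (h2 : j ≤ g - 1) (h3 : j % 2 = g % 2) :
      ∑ i, x i ^ p ^ (u + j) * a i ^ p ^ u
        = (-1) ^ g * ∑ i, x i ^ p ^ u * a i ^ p ^ (u + j) := by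
    have := congrArg (· ^ p ^ u) (h j h1 h2 h3)
    simp only [mul_pow _ _ (p ^ u), sum_pow_prime_pow, neg_one_pow_pow_prime_pow] at this
    simpa only [← pow_mul (_ : k) (p ^ _) (p ^ _), ← pow_add, add_comm j u] using this
  rcases lt_trichotomy s t with hlt | rfl | hlt
  · obtain ⟨j, rfl⟩ := Nat.exists_eq_add_of_lt hlt
    rw [add_assoc, key s (j + 1) (by omega) (by omega) (by omega), ← mul_assoc, ← mul_pow]
    simp
  · have hg : Even g := Nat.even_iff.2 (by omega)
    rw [hg.neg_one_pow, one_mul]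
  · obtain ⟨j, rfl⟩ := Nat.exists_eq_add_of_lt hlt
    rw [add_assoc]
    exact key t (j + 1) (by omega) (by omega) (by omega)

lemma completeUpper_fixed {b : Fin n → Fin n → k} (g : ℕ)
    (hb : ∀ i l, i ≤ l → b i l ^ p ^ 2 = b i l) (i l : Fin n) :
    completeUpper p g b i l ^ p ^ 2 = completeUpper p g b i l := by
  unfold completeUpper
  split_ifs with h
  · exact hb i l h
  · exact neg_one_pow_mul_fixed (pow_prime_pow_fixed (hb l i (not_le.1 h).le) g) g

/-- The completed matrix is `(-1) ^ g`-hermitian. -/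
lemma completeUpper_symm {b : Fin n → Fin n → k} {g : ℕ}
    (hb : ∀ i l, i ≤ l → b i l ^ p ^ 2 = b i l) (hdiag : Odd g → ∀ i, b i i ^ p = -b i i)
    (i l : Fin n) :
    completeUpper p g b l i ^ p ^ g = (-1) ^ g * completeUpper p g b i l := by
  unfold completeUpper
  rcases lt_trichotomy i l with h | rfl | h
  · rw [if_neg h.not_ge, if_pos h.le, mul_pow, neg_one_pow_pow_prime_pow, ← pow_mul, ← pow_add,
      ← two_mul, pow_prime_pow_two_mul (hb i l h.le)]
  · rw [if_pos le_rfl]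
    rcases Nat.even_or_odd g with hg | hg
    · rw [pow_prime_pow_congr (hb i i le_rfl) (j := 0) (by have := Nat.even_iff.1 hg; omega)]
      simp [hg.neg_one_pow]
    · rw [pow_prime_pow_congr (hb i i le_rfl) (j := 1) (by have := Nat.odd_iff.1 hg; omega)]
      simp [hg.neg_one_pow, hdiag hg i]
  · rw [if_neg h.not_ge, if_pos h.le, ← mul_assoc, ← mul_pow]
    simp

/-- For `x = B a` with `B` fixed by `x ↦ x ^ p ^ 2`, both sides of the relation are bilinear
expressions in `a` and its twist. -/
lemma relation_sub_eq {g j : ℕ} (hj : j % 2 = g % 2) {B : Fin n → Fin n → k}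
    (hB : ∀ i l, B i l ^ p ^ 2 = B i l) :
    ∑ i, (∑ l, B i l * a l) ^ p ^ j * a i - (-1) ^ g * ∑ i, (∑ l, B i l * a l) * a i ^ p ^ j
      = ∑ i, (∑ l, (B l i ^ p ^ g - (-1) ^ g * B i l) * a l) * a i ^ p ^ j := by
  have h1 : ∑ i, (∑ l, B i l * a l) ^ p ^ j * a i
      = ∑ i, ∑ l, B l i ^ p ^ g * a l * a i ^ p ^ j := by
    rw [Finset.sum_comm]
    refine Finset.sum_congr rfl fun i _ => ?_
    rw [sum_pow_prime_pow, Finset.sum_mul]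
    refine Finset.sum_congr rfl fun l _ => ?_
    rw [mul_pow, pow_prime_pow_congr (hB i l) hj]
    ring
  rw [h1, Finset.mul_sum, ← Finset.sum_sub_distrib]
  refine Finset.sum_congr rfl fun i _ => ?_
  rw [Finset.sum_mul, Finset.sum_mul, Finset.mul_sum, ← Finset.sum_sub_distrib]
  exact Finset.sum_congr rfl fun l _ => by ring

/-- Solutions of the relations are `B a` for a `(-1) ^ g`-hermitian matrix `B`. -/
lemma FixedIndep.exists_hermitian [IsAlgClosed k] (ha : FixedIndep p a) {g : ℕ} (hg : 2 ≤ g)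
    (hn : n = (g - 1) / 2) {x : Fin n → k}
    (h : ∀ j, 1 ≤ j → j ≤ g - 1 → j % 2 = g % 2 →
      ∑ i, x i ^ p ^ j * a i = (-1) ^ g * ∑ i, x i * a i ^ p ^ j) :
    ∃ B : Fin n → Fin n → k, (∀ i l, B i l ^ p ^ 2 = B i l) ∧
      (∀ i l, B l i ^ p ^ g = (-1) ^ g * B i l) ∧ ∀ i, x i = ∑ l, B i l * a l := by
  obtain ⟨B, hB, hx⟩ := ha.mem_span (g % 2) ((-1) ^ g) fun s hs t ht =>
    twisted_relation h (s := 2 * s) (t := g % 2 + 2 * t) (by omega) (by omega) (by omega)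
  obtain rfl : x = fun i => ∑ l, B i l * a l := funext hx
  refine ⟨B, hB, fun i l => ?_, hx⟩
  have hy := ha.moore (2 - g % 2)
    (y := fun i => ∑ l, (B l i ^ p ^ g - (-1) ^ g * B i l) * a l) fun t => by
      rw [← relation_sub_eq (by omega) hB, sub_eq_zero]
      exact h _ (by omega) (by omega) (by omega)
  exact sub_eq_zero.1 (ha (fun l => B l i ^ p ^ g - (-1) ^ g * B i l)
    (fun l => sub_fixed (pow_prime_pow_fixed (hB l i) g) (neg_one_pow_mul_fixed (hB i l) g))
    (congrFun hy i) l)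

lemma frobeniusEquiv_pow_apply [PerfectRing k p] (j : ℕ) (x : k) :
    ((frobeniusEquiv k p : RingAut k) ^ j) x = x ^ p ^ j := by
  induction j generalizing x with
  | zero => simp
  | succ j ih =>
    rw [pow_succ, RingAut.mul_apply, ih, pow_succ', pow_mul]
    rfl

end

/-- Let `g ≥ 2`, `n = ⌊(g−1)/2⌋`, `a_1, …, a_n ∈ k` linearly independent over
`𝔽_{p²}`, and `J = {j : 1 ≤ j ≤ g−1, j ≡ g (mod 2)}`. Then the set of solutions
`(x_1, …, x_n)` of `∑_i ((−1)^(g−1)·x_i·σ^j(a_i) + σ^j(x_i)·a_i) = 0` for all `j ∈ J`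
is exactly the set of tuples `x_i = b_ii·a_i + ∑_{l>i} b_il·a_l + (−1)^g·∑_{l<i} σ^g(b_li)·a_l`
with parameters `b_il ∈ 𝔽_{p²}` for `i ≤ l`, where moreover `σ(b_ii) = −b_ii` when `g` is odd;
and distinct parameter choices give distinct tuples. -/
theorem stmt3 (p : ℕ) [Fact p.Prime] (k : Type*) [Field k] [IsAlgClosed k] [CharP k p]
    (g : ℕ) (hg : 2 ≤ g) (n : ℕ) (hn : n = (g - 1) / 2) (a : Fin n → k)
    (ha : ∀ c : Fin n → k, (∀ i, c i ^ p ^ 2 = c i) → ∑ i, c i * a i = 0 → ∀ i, c i = 0)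
    (J : Finset ℕ) (hJ : J = (Finset.Icc 1 (g - 1)).filter fun j => j % 2 = g % 2) :
    ({x : Fin n → k | ∀ j ∈ J, ∑ i,
        ((-1 : k) ^ (g - 1) * x i * ((frobeniusEquiv k p : RingAut k) ^ j) (a i)
          + ((frobeniusEquiv k p : RingAut k) ^ j) (x i) * a i) = 0}
      = {x : Fin n → k | ∃ b : Fin n → Fin n → k,
          ((∀ i l : Fin n, i ≤ l → b i l ^ p ^ 2 = b i l) ∧
            (Odd g → ∀ i : Fin n, frobeniusEquiv k p (b i i) = - b i i)) ∧
          ∀ i : Fin n, x i = b i i * a i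
            + ∑ l ∈ Finset.univ.filter (fun l => i < l), b i l * a l
            + (-1 : k) ^ g * ∑ l ∈ Finset.univ.filter (fun l => l < i),
                ((frobeniusEquiv k p : RingAut k) ^ g) (b l i) * a l})
    ∧
    (∀ b b' : Fin n → Fin n → k,
      ((∀ i l : Fin n, i ≤ l → b i l ^ p ^ 2 = b i l) ∧
        (Odd g → ∀ i : Fin n, frobeniusEquiv k p (b i i) = - b i i)) →
      ((∀ i l : Fin n, i ≤ l → b' i l ^ p ^ 2 = b' i l) ∧
        (Odd g → ∀ i : Fin n, frobeniusEquiv k p (b' i i) = - b' i i)) →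
      (∀ i : Fin n,
        (b i i * a i
            + ∑ l ∈ Finset.univ.filter (fun l => i < l), b i l * a l
            + (-1 : k) ^ g * ∑ l ∈ Finset.univ.filter (fun l => l < i),
                ((frobeniusEquiv k p : RingAut k) ^ g) (b l i) * a l)
          = (b' i i * a i
            + ∑ l ∈ Finset.univ.filter (fun l => i < l), b' i l * a l
            + (-1 : k) ^ g * ∑ l ∈ Finset.univ.filter (fun l => l < i),
                ((frobeniusEquiv k p : RingAut k) ^ g) (b' l i) * a l)) →
      ∀ i l : Fin n, i ≤ l → b i l = b' i l) := by
  simp only [frobeniusEquiv_pow_apply, sum_completeUpper, frobeniusEquiv_apply]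
  have ha' : FixedIndep p a := ha
  have hsign : (-1 : k) ^ (g - 1) = -(-1) ^ g := by
    obtain ⟨m, rfl⟩ := Nat.exists_eq_add_of_le' (one_le_two.trans hg)
    simp [pow_succ]
  have hrel (x : Fin n → k) (j : ℕ) :
      ∑ i, ((-1 : k) ^ (g - 1) * x i * a i ^ p ^ j + x i ^ p ^ j * a i) = 0 ↔
        ∑ i, x i ^ p ^ j * a i = (-1) ^ g * ∑ i, x i * a i ^ p ^ j := by
    simp only [hsign, Finset.sum_add_distrib, neg_mul, Finset.sum_neg_distrib, mul_assoc,
      ← Finset.mul_sum]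
    rw [neg_add_eq_zero, eq_comm]
  refine ⟨?_, fun b b' hb hb' h i l hil => ?_⟩
  · ext x
    simp only [Set.mem_ofPred_eq, hrel, hJ, Finset.mem_filter, Finset.mem_Icc]
    constructor
    · intro h
      obtain ⟨B, hB, hsymm, hx⟩ :=
        ha'.exists_hermitian hg hn fun j h1 h2 h3 => h j ⟨⟨h1, h2⟩, h3⟩
      refine ⟨B, ⟨fun i l _ => hB i l, fun hodd i => ?_⟩, fun i => ?_⟩
      · have := hsymm i i
        rw [pow_prime_pow_congr (hB i i) (j := 1) (by have := Nat.odd_iff.1 hodd; omega)] at this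
        simpa [hodd.neg_one_pow, frobenius_def] using this
      · rw [hx i]
        refine Finset.sum_congr rfl fun l _ => ?_
        unfold completeUpper
        split_ifs
        · rfl
        · rw [hsymm i l, ← mul_assoc, ← mul_pow]
          simp
    · rintro ⟨b, ⟨hb, hdiag⟩, hx⟩ j ⟨-, hj⟩
      obtain rfl : x = fun i => ∑ l, completeUpper p g b i l * a l := funext hx
      rw [← sub_eq_zero, relation_sub_eq hj (completeUpper_fixed g hb)]
      simp [completeUpper_symm hb hdiag]
  · have hB := ha'.ext (completeUpper_fixed g hb.1 i) (completeUpper_fixed g hb'.1 i) (h i)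
    simpa [completeUpper, hil] using congrFun hB l
end

section
/- Let g ≥ 2 be even and let a_1, …, a_g ∈ k. Assume that a_1, …, a_{g/2+1} are linearly independent over 𝔽_{p²} and that (a_1, …, a_g) satisfies the self-duality relations R_g. Then a_1, …, a_g are linearly independent over 𝔽_{p²}. -/
open Finset

/-- The self-duality relations `R_g` on a tuple `(a_1, …, a_g)` (indexed here by `1, …, g`):
for `g` even, `∑_{i=1}^{g/2−1}(−a_{g+1−i}·σ^j(a_i) + σ^j(a_{g+1−i})·a_i)
= −a_{g/2}·σ^j(a_{g/2+1}) + σ^j(a_{g/2})·a_{g/2+1}` for every even `j` with `1 ≤ j < g−1`;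
for `g` odd with `m = (g+1)/2`, `∑_{i=1}^{(g−1)/2}(a_{g+1−i}·σ^j(a_i) + σ^j(a_{g+1−i})·a_i)
= (−1)^m·a_m·σ^j(a_m)` for every odd `j` with `1 ≤ j < g−1`. -/
def SelfDualRelations (p : ℕ) [Fact p.Prime] {k : Type*} [Field k] [IsAlgClosed k] [CharP k p]
    (g : ℕ) (a : ℕ → k) : Prop :=
  if Even g then
    ∀ j : ℕ, 1 ≤ j → j < g - 1 → Even j →
      ∑ i ∈ Finset.Icc 1 (g / 2 - 1),
        (-(a (g + 1 - i)) * ((frobeniusEquiv k p : RingAut k) ^ j) (a i)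
          + ((frobeniusEquiv k p : RingAut k) ^ j) (a (g + 1 - i)) * a i)
        = -(a (g / 2)) * ((frobeniusEquiv k p : RingAut k) ^ j) (a (g / 2 + 1))
          + ((frobeniusEquiv k p : RingAut k) ^ j) (a (g / 2)) * a (g / 2 + 1)
  else
    ∀ j : ℕ, 1 ≤ j → j < g - 1 → Odd j →
      ∑ i ∈ Finset.Icc 1 ((g - 1) / 2),
        (a (g + 1 - i) * ((frobeniusEquiv k p : RingAut k) ^ j) (a i)
          + ((frobeniusEquiv k p : RingAut k) ^ j) (a (g + 1 - i)) * a i)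
        = (-1 : k) ^ ((g + 1) / 2) * a ((g + 1) / 2)
          * ((frobeniusEquiv k p : RingAut k) ^ j) (a ((g + 1) / 2))

/-- The Moore matrix `(τ^i (w j))` of elements `w j` that are linearly independent over the
fixed field of `τ` has linearly independent columns. -/
theorem eq_zero_of_sum_mul_pow_apply_eq_zero {k : Type*} [Field k] (τ : RingAut k) (m : ℕ)
    (w μ : ℕ → k)
    (hw : ∀ c : ℕ → k, (∀ i, τ (c i) = c i) → ∑ i ∈ range m, c i * w i = 0 →
      ∀ i ∈ range m, c i = 0)
    (hμ : ∀ i < m, ∑ j ∈ range m, μ j * (τ ^ i) (w j) = 0) :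
    ∀ j < m, μ j = 0 := by
  induction m generalizing w μ with
  | zero => intro j hj; omega
  | succ m ih =>
    have hw' : ∀ c : ℕ → k, (∀ i, τ (c i) = c i) → ∑ i ∈ range m, c i * w i = 0 →
        ∀ i ∈ range m, c i = 0 := by
      intro c hc hsum i hi
      have hi' := Finset.mem_range.1 hi
      have := hw (fun i => if i < m then c i else 0)
        (fun i => by split_ifs <;> simp [hc])
        (by
          rw [Finset.sum_range_succ, if_neg (lt_irrefl m), zero_mul, add_zero]
          refine Eq.trans ?_ hsum
          exact Finset.sum_congr rfl fun i hi => by rw [if_pos (Finset.mem_range.1 hi)])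
        i (by simp; omega)
      simpa [hi'] using this
    by_cases hm : μ m = 0
    · have := ih w μ hw' fun i hi => by
        simpa [Finset.sum_range_succ, hm] using hμ i (by omega)
      intro j hj
      rcases Nat.lt_succ_iff_lt_or_eq.1 hj with h | rfl
      exacts [this j h, hm]
    · exfalso
      have hν : ∀ i < m + 1, ∑ j ∈ range m, μ j / μ m * (τ ^ i) (w j) + (τ ^ i) (w m) = 0 := by
        intro i hi
        have h := hμ i hi
        rw [Finset.sum_range_succ] at h
        calc _ = (∑ j ∈ range m, μ j * (τ ^ i) (w j) + μ m * (τ ^ i) (w m)) / μ m := by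
              rw [add_div, Finset.sum_div, mul_div_cancel_left₀ _ hm]
              congr 1
              exact Finset.sum_congr rfl fun j _ => by ring
          _ = 0 := by rw [h, zero_div]
      have hfix := ih (fun j => τ (w j)) (fun j => τ (μ j / μ m) - μ j / μ m)
        (by
          intro c hc hsum
          refine hw' c hc (τ.injective ?_)
          rw [map_zero, ← hsum, map_sum]
          exact Finset.sum_congr rfl fun i _ => by rw [map_mul, hc])
        (by
          intro i hi
          have h1 := congrArg τ (hν i (by omega))
          have h2 := hν (i + 1) (by omega)
          have e : ∀ x, τ ((τ ^ i) x) = (τ ^ i) (τ x) := fun x => by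
            rw [← RingAut.mul_apply, ← RingAut.mul_apply, ← pow_succ, ← pow_succ']
          have e' : ∀ x, (τ ^ (i + 1)) x = (τ ^ i) (τ x) := fun x => by
            rw [pow_succ, RingAut.mul_apply]
          simp only [map_add, map_sum, map_mul, e, map_zero] at h1
          simp only [e'] at h2
          simp only [sub_mul, Finset.sum_sub_distrib]
          linear_combination h1 - h2)
      have := hw (fun j => if j < m then μ j / μ m else 1)
        (fun j => by
          split_ifs with h
          · exact sub_eq_zero.1 (hfix j h)
          · exact map_one τ)
        (by
          rw [Finset.sum_range_succ, ← hν 0 (by omega)]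
          congr 1
          · exact Finset.sum_congr rfl fun i hi => by
              simp [Finset.mem_range.1 hi]
          · simp)
        m (by simp)
      simp at this

/-- The Moore matrix of elements that are linearly independent over the fixed field of `τ` has
linearly independent rows. -/
theorem linearIndependent_moore {k : Type*} [Field k] (τ : RingAut k) (m : ℕ) (w : ℕ → k)
    (hw : ∀ c : ℕ → k, (∀ i, τ (c i) = c i) → ∑ i ∈ range m, c i * w i = 0 →
      ∀ i ∈ range m, c i = 0) :
    LinearIndependent k fun (i : Fin m) (j : Fin m) => (τ ^ (i : ℕ)) (w j) := by
  change LinearIndependent k (Matrix.of fun (i j : Fin m) => (τ ^ (i : ℕ)) (w j)).row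
  rw [Matrix.linearIndependent_rows_iff_isUnit, ← Matrix.mulVec_injective_iff_isUnit,
    ← Matrix.coe_mulVecLin, injective_iff_map_eq_zero]
  intro μ hμ
  have := eq_zero_of_sum_mul_pow_apply_eq_zero τ m w
    (fun j => if h : j < m then μ ⟨j, h⟩ else 0) hw
    (by
      intro i hi
      rw [Finset.sum_range]
      have := congrFun hμ ⟨i, hi⟩
      simpa [Matrix.mulVec, dotProduct, mul_comm] using this)
  ext j
  simpa using this j j.2

/-- A totally isotropic family of linearly independent vectors for a nondegenerate form
has at most half as many members as the dimension. -/
theorem two_mul_le_finrank_of_isotropic {k V : Type*} [Field k] [AddCommGroup V] [Module k V]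
    [FiniteDimensional k V] (B : LinearMap.BilinForm k V) (hB : B.Nondegenerate)
    {m : ℕ} (s : Fin m → V) (hs : LinearIndependent k s) (h : ∀ i j, B (s i) (s j) = 0) :
    2 * m ≤ Module.finrank k V := by
  have hle : Submodule.span k (Set.range s) ≤ B.orthogonal (Submodule.span k (Set.range s)) := by
    rw [Submodule.span_le]
    rintro _ ⟨j, rfl⟩
    change ∀ x ∈ Submodule.span k (Set.range s), B x (s j) = 0
    intro x hx
    induction hx using Submodule.span_induction with
    | mem x hx => obtain ⟨i, rfl⟩ := hx; exact h i j
    | zero => simp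
    | add x y _ _ hx hy => simp [hx, hy]
    | smul c x _ hx => simp [hx]
  have h1 := Submodule.finrank_mono hle
  have h2 := LinearMap.BilinForm.finrank_orthogonal hB (Submodule.span k (Set.range s))
  have h3 := Submodule.finrank_le (Submodule.span k (Set.range s))
  rw [h2] at h1
  rw [finrank_span_eq_card hs, Fintype.card_fin] at h1 h3
  omega

/-- If `u, τ u, …, τ^n u` are linearly independent, then no nonzero `τ`-fixed vector is a
combination of `u, τ u, …, τ^(n-1) u`. -/
theorem eq_zero_of_fixed_of_eq_sum {k ι : Type*} [Field k] (τ : RingAut k) (n : ℕ)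
    (u v : ι → k)
    (hu : LinearIndependent k fun (i : Fin (n + 1)) (j : ι) => (τ ^ (i : ℕ)) (u j))
    (hv : ∀ j, τ (v j) = v j) (l : ℕ → k)
    (hl : ∀ j, v j = ∑ i ∈ range n, l i * (τ ^ i) (u j)) : v = 0 := by
  rw [Fintype.linearIndependent_iff] at hu
  have key := hu (fun i => (if (i : ℕ) = 0 then 0 else τ (l (i - 1))) -
      if (i : ℕ) < n then l i else 0) (by
    ext j
    simp only [Finset.sum_apply, Pi.smul_apply, smul_eq_mul, Pi.zero_apply, sub_mul,
      Finset.sum_sub_distrib]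
    rw [← Finset.sum_range (fun i => (if i = 0 then 0 else τ (l (i - 1))) * (τ ^ i) (u j)),
      ← Finset.sum_range (fun i => (if i < n then l i else 0) * (τ ^ i) (u j)),
      Finset.sum_range_succ', Finset.sum_range_succ (fun i => (if i < n then l i else 0) * _)]
    have h1 := congrArg τ (hl j)
    rw [hv, map_sum] at h1
    have h2 : ∑ i ∈ range n, (if i < n then l i else 0) * (τ ^ i) (u j) = v j := by
      rw [hl]
      exact Finset.sum_congr rfl fun i hi => by rw [if_pos (Finset.mem_range.1 hi)]
    rw [h2]
    simp only [Nat.succ_ne_zero, if_false, Nat.add_sub_cancel, if_true, zero_mul, add_zero,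
      lt_irrefl]
    rw [sub_eq_zero, h1]
    exact Finset.sum_congr rfl fun i _ => by rw [map_mul, pow_succ', RingAut.mul_apply])
  have hl0 : ∀ i < n, l i = 0 := by
    intro i
    induction i with
    | zero => intro hi; simpa [hi] using key 0
    | succ i ih =>
      intro hi
      have := key ⟨i + 1, by omega⟩
      simpa [hi, ih (by omega)] using this
  ext j
  rw [hl, Pi.zero_apply]
  exact Finset.sum_eq_zero fun i hi => by rw [hl0 i (Finset.mem_range.1 hi), zero_mul]

/-- A `τ`-fixed vector orthogonal to the Lagrangian subspace spanned by `u, τ u, …, τ^(n-1) u`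
vanishes. -/
theorem eq_zero_of_fixed_of_orthogonal {k ι : Type*} [Field k] [Fintype ι] (τ : RingAut k) (n : ℕ)
    (hι : Fintype.card ι = 2 * n) (B : LinearMap.BilinForm k (ι → k)) (hB : B.Nondegenerate)
    (halt : B.IsAlt) (hτ : ∀ x y : ι → k, B (fun j => τ (x j)) (fun j => τ (y j)) = τ (B x y))
    (u v : ι → k)
    (hu : LinearIndependent k fun (i : Fin (n + 1)) (j : ι) => (τ ^ (i : ℕ)) (u j))
    (hiso : ∀ l, 1 ≤ l → l < n → B u (fun j => (τ ^ l) (u j)) = 0)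
    (hv : ∀ j, τ (v j) = v j) (hvu : B v u = 0) : v = 0 := by
  have hpow : ∀ (i : ℕ) (x y : ι → k),
      B (fun j => (τ ^ i) (x j)) (fun j => (τ ^ i) (y j)) = (τ ^ i) (B x y) := by
    intro i x y
    induction i with
    | zero => simp
    | succ i ih => simp only [pow_succ', RingAut.mul_apply]; rw [hτ, ih]
  have hvi : ∀ i : ℕ, (fun j => (τ ^ i) (v j)) = v := by
    intro i
    ext j
    induction i with
    | zero => simp
    | succ i ih => rw [pow_succ, RingAut.mul_apply, hv, ih]
  have hvorth : ∀ i : ℕ, B v (fun j => (τ ^ i) (u j)) = 0 := by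
    intro i
    have := hpow i v u
    rwa [hvi, hvu, map_zero] at this
  have hle : ∀ i l : ℕ, i + l < n →
      B (fun j => (τ ^ i) (u j)) (fun j => (τ ^ (i + l)) (u j)) = 0 := by
    intro i l hil
    simp only [pow_add, RingAut.mul_apply]
    rw [hpow]
    rcases Nat.eq_zero_or_pos l with rfl | hl
    · simp [halt u]
    · rw [hiso l hl (by omega), map_zero]
  have huu : ∀ i j : Fin n,
      B (fun t => (τ ^ (i : ℕ)) (u t)) (fun t => (τ ^ (j : ℕ)) (u t)) = 0 := by
    intro i j
    rcases le_total (i : ℕ) j with h | h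
    · obtain ⟨l, hl⟩ := Nat.exists_eq_add_of_le h
      rw [hl]; exact hle i l (by omega)
    · obtain ⟨l, hl⟩ := Nat.exists_eq_add_of_le h
      apply halt.isRefl
      rw [hl]; exact hle j l (by omega)
  have hun : LinearIndependent k fun (i : Fin n) (j : ι) => (τ ^ (i : ℕ)) (u j) :=
    hu.comp (Fin.castSucc) (Fin.castSucc_injective n)
  by_cases hmem : v ∈ Submodule.span k
      (Set.range fun (i : Fin n) (j : ι) => (τ ^ (i : ℕ)) (u j))
  · obtain ⟨l, hl⟩ := (Submodule.mem_span_range_iff_exists_fun k).1 hmem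
    refine eq_zero_of_fixed_of_eq_sum τ n u v hu hv
      (fun i => if h : i < n then l ⟨i, h⟩ else 0) fun j => ?_
    rw [Finset.sum_range, ← hl]
    simp
  · exfalso
    have := two_mul_le_finrank_of_isotropic B hB _
      (linearIndependent_finCons.2 ⟨hun, hmem⟩) (by
        intro i j
        refine Fin.cases ?_ (fun i => ?_) i <;> refine Fin.cases ?_ (fun j => ?_) j
        · exact halt v
        · exact hvorth j
        · exact halt.isRefl _ _ (hvorth i)
        · exact huu i j)
    rw [Module.finrank_pi, hι] at this
    omega

/-- The form `∑ i, ε i * x i * y (rev i)`, alternating when `ε (rev i) = -ε i`. -/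
def antidiagForm {k : Type*} [Field k] {N : ℕ} (ε : Fin N → k) :
    LinearMap.BilinForm k (Fin N → k) :=
  LinearMap.mk₂ k (fun x y => ∑ i, ε i * x i * y i.rev)
    (fun x y z => by simp [mul_add, add_mul, Finset.sum_add_distrib])
    (fun c x y => by
      rw [smul_eq_mul, Finset.mul_sum]
      exact Finset.sum_congr rfl fun i _ => by simp; ring)
    (fun x y z => by simp [mul_add, Finset.sum_add_distrib])
    (fun c x y => by
      rw [smul_eq_mul, Finset.mul_sum]
      exact Finset.sum_congr rfl fun i _ => by simp; ring)

theorem antidiagForm_apply {k : Type*} [Field k] {N : ℕ} (ε x y : Fin N → k) :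
    antidiagForm ε x y = ∑ i, ε i * x i * y i.rev := rfl

theorem antidiagForm_nondegenerate {k : Type*} [Field k] {N : ℕ} (ε : Fin N → k)
    (hε : ∀ i, ε i ≠ 0) : (antidiagForm ε).Nondegenerate := by
  refine ⟨fun x hx => ?_, fun y hy => ?_⟩
  · ext i
    have := hx (Pi.single i.rev 1)
    rw [antidiagForm_apply, Finset.sum_eq_single i] at this
    · simpa [hε] using this
    · intro j _ hj
      rw [Pi.single_eq_of_ne (fun h => hj (Fin.rev_injective h)), mul_zero]
    · simp
  · ext i
    have := hy (Pi.single i.rev 1)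
    rw [antidiagForm_apply, Finset.sum_eq_single i.rev] at this
    · simpa [hε] using this
    · intro j _ hj
      rw [Pi.single_eq_of_ne hj, mul_zero, zero_mul]
    · simp

theorem antidiagForm_apply_two_mul {k : Type*} [Field k] {n : ℕ} (ε x y : Fin (2 * n) → k)
    (hε : ∀ i, ε i.rev = -ε i) (X Y E : ℕ → k) (hX : ∀ i, x i = X i) (hY : ∀ i, y i = Y i)
    (hE : ∀ i, ε i = E i) :
    antidiagForm ε x y =
      ∑ i ∈ range n, E i * (X i * Y (2 * n - 1 - i) - X (2 * n - 1 - i) * Y i) := by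
  have hrev : ∀ i < 2 * n, E (2 * n - 1 - i) = -E i := by
    intro i hi
    have := hε ⟨i, hi⟩
    rw [hE, hE, Fin.val_rev] at this
    rw [← this]
    congr 1
    dsimp only
    omega
  have h : antidiagForm ε x y = ∑ i ∈ range (2 * n), E i * X i * Y (2 * n - 1 - i) := by
    rw [antidiagForm_apply, Finset.sum_range]
    refine Finset.sum_congr rfl fun i _ => ?_
    rw [hX, hY, hE, Fin.val_rev]
    congr 2
    omega
  rw [h, two_mul, Finset.sum_range_add,
    ← Finset.sum_range_reflect (fun i => E (n + i) * X (n + i) * _), ← Finset.sum_add_distrib]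
  refine Finset.sum_congr rfl fun i hi => ?_
  have hi := Finset.mem_range.1 hi
  have e1 : n + (n - 1 - i) = 2 * n - 1 - i := by omega
  have e2 : n + n - 1 - (2 * n - 1 - i) = i := by omega
  rw [e1, e2, hrev i (by omega), ← two_mul]
  ring

theorem antidiagForm_isAlt {k : Type*} [Field k] {n : ℕ} (ε : Fin (2 * n) → k)
    (hε : ∀ i, ε i.rev = -ε i) : (antidiagForm ε).IsAlt := by
  intro x
  let F (f : Fin (2 * n) → k) (j : ℕ) : k := if h : j < 2 * n then f ⟨j, h⟩ else 0
  have hF : ∀ (f : Fin (2 * n) → k) (i : Fin (2 * n)), f i = F f i := by simp [F]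
  rw [antidiagForm_apply_two_mul ε x x hε (F x) (F x) (F ε) (hF x) (hF x) (hF ε)]
  exact Finset.sum_eq_zero fun i _ => by ring

/-- Let `g ≥ 2` be even and `a_1, …, a_g ∈ k`. If `a_1, …, a_{g/2+1}` are
linearly independent over `𝔽_{p²}` and `(a_1, …, a_g)` satisfies the self-duality
relations `R_g`, then `a_1, …, a_g` are linearly independent over `𝔽_{p²}`. -/
theorem stmt4 (p : ℕ) [Fact p.Prime] (k : Type*) [Field k] [IsAlgClosed k] [CharP k p]
    (g : ℕ) (hg : 2 ≤ g) (hgeven : Even g) (a : ℕ → k)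
    (hindep : ∀ c : ℕ → k, (∀ i, c i ^ p ^ 2 = c i) →
      ∑ i ∈ Finset.Icc 1 (g / 2 + 1), c i * a i = 0 →
      ∀ i ∈ Finset.Icc 1 (g / 2 + 1), c i = 0)
    (hrel : SelfDualRelations p g a) :
    ∀ c : ℕ → k, (∀ i, c i ^ p ^ 2 = c i) →
      ∑ i ∈ Finset.Icc 1 g, c i * a i = 0 →
      ∀ i ∈ Finset.Icc 1 g, c i = 0 := by
  obtain ⟨n, rfl⟩ := hgeven.exists_two_nsmul
  simp only [smul_eq_mul] at *
  have hn : 1 ≤ n := by omega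
  have hdiv : 2 * n / 2 = n := by omega
  set τ : RingAut k := (frobeniusEquiv k p : RingAut k) ^ 2 with hτ
  have hτpow : ∀ x, τ x = x ^ p ^ 2 := by
    intro x
    rw [hτ, pow_two, RingAut.mul_apply, frobeniusEquiv_apply, frobeniusEquiv_apply,
      frobenius_def, frobenius_def, ← pow_mul, pow_two]
  have hshift : ∀ (m : ℕ) (f : ℕ → k), ∑ i ∈ Icc 1 m, f i = ∑ i ∈ range m, f (i + 1) := by
    intro m f
    rw [Finset.range_eq_Ico, Finset.sum_Ico_add' f 0 m 1]
    rfl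
  set E : ℕ → k := fun i => if i < n then 1 else -1 with hE
  set ε : Fin (2 * n) → k := fun i => E i with hεdef
  have hεne : ∀ i, ε i ≠ 0 := by
    intro i
    simp only [hεdef, hE]
    split_ifs <;> simp
  have hετ : ∀ i, τ (ε i) = ε i := by
    intro i
    simp only [hεdef, hE]
    split_ifs <;> simp
  have hεrev : ∀ i, ε i.rev = -ε i := by
    intro i
    simp only [hεdef, hE, Fin.val_rev]
    have := i.2
    split_ifs <;> first | omega | simp
  set u : Fin (2 * n) → k := fun i => a (i + 1) with hu
  have hmoore : LinearIndependent k
      fun (i : Fin (n + 1)) (j : Fin (2 * n)) => (τ ^ (i : ℕ)) (u j) := by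
    have h := linearIndependent_moore τ (n + 1) (fun j => a (j + 1)) (by
      intro c hc hsum i hi
      have h := hindep (fun i => c (i - 1)) (fun i => by rw [← hτpow, hc])
        (by rw [hdiv, hshift]; simpa using hsum) (i + 1)
        (by rw [hdiv]; simp at hi ⊢; omega)
      simpa using h)
    exact LinearIndependent.of_comp
      (LinearMap.funLeft k k (Fin.castLE (by omega : n + 1 ≤ 2 * n))) h
  intro c hc hsum
  have hv := eq_zero_of_fixed_of_orthogonal τ n (by simp) (antidiagForm ε)
    (antidiagForm_nondegenerate ε hεne) (antidiagForm_isAlt ε hεrev)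
    (by
      intro x y
      simp only [antidiagForm_apply, map_sum, map_mul, hετ])
    u (fun i => (ε i)⁻¹ * c (i.rev + 1)) hmoore
    (by
      intro l hl hln
      have hr := hrel
      rw [SelfDualRelations, if_pos hgeven] at hr
      have hr := hr (2 * l) (by omega) (by omega) (even_two_mul l)
      rw [pow_mul, ← hτ, hdiv, hshift] at hr
      rw [antidiagForm_apply_two_mul ε _ _ hεrev (fun i => a (i + 1))
        (fun i => (τ ^ l) (a (i + 1))) E (fun _ => rfl) (fun _ => rfl) (fun _ => rfl)]
      obtain ⟨m, rfl⟩ : ∃ m, n = m + 1 := ⟨n - 1, by omega⟩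
      have hsplit : ∑ i ∈ range m, E i * (a (i + 1) * (τ ^ l) (a (2 * (m + 1) - 1 - i + 1)) -
            a (2 * (m + 1) - 1 - i + 1) * (τ ^ l) (a (i + 1))) =
          ∑ i ∈ range (m + 1 - 1), (-a (2 * (m + 1) + 1 - (i + 1)) * (τ ^ l) (a (i + 1)) +
            (τ ^ l) (a (2 * (m + 1) + 1 - (i + 1))) * a (i + 1)) := by
        refine Finset.sum_congr rfl fun i hi => ?_
        have hi := Finset.mem_range.1 hi
        have e1 : 2 * (m + 1) - 1 - i + 1 = 2 * (m + 1) + 1 - (i + 1) := by omega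
        have e2 : E i = 1 := if_pos (by omega)
        rw [e1, e2]
        ring
      have e1 : 2 * (m + 1) - 1 - m + 1 = m + 1 + 1 := by omega
      have e2 : E m = 1 := if_pos (by omega)
      rw [Finset.sum_range_succ, hsplit, hr, e1, e2]
      ring)
    (by
      intro j
      rw [map_mul, map_inv₀, hετ, hτpow, hc])
    (by
      rw [antidiagForm_apply, ← Equiv.sum_comp Fin.revPerm, ← hsum, hshift, Finset.sum_range]
      refine Finset.sum_congr rfl fun i _ => ?_
      rw [Fin.revPerm_apply, Fin.rev_rev, mul_inv_cancel_left₀ (hεne _)])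
  intro i hi
  obtain ⟨h1, h2⟩ := Finset.mem_Icc.1 hi
  have h := congrFun hv (Fin.rev ⟨i - 1, by omega⟩)
  simpa [hεne, Nat.sub_add_cancel h1] using h
end

section
/- Let g ≥ 3 be odd, set m = (g+1)/2, and let a_1, …, a_g ∈ k. Assume that a_1, …, a_m are linearly independent over 𝔽_{p²} and that (a_1, …, a_g) satisfies the self-duality relations R_g. Then a_1, …, a_g are linearly independent over 𝔽_{p²}. -/
open Finset

/-- A family is independent over the fixed field of `τ`: no nonzero `τ`-fixed coefficients
annihilate it. -/
def FixedIndependent {k ι : Type*} [Field k] [Fintype ι] (τ : RingAut k) (a : ι → k) : Prop :=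
  ∀ c : ι → k, (∀ i, τ (c i) = c i) → ∑ i, c i * a i = 0 → c = 0

lemma FixedIndependent.castSucc {k : Type*} [Field k] {τ : RingAut k} {n : ℕ}
    {a : Fin (n + 1) → k} (h : FixedIndependent τ a) :
    FixedIndependent τ (fun i : Fin n => a i.castSucc) := by
  intro c hc hsum
  have h0 := h (Fin.snoc c 0) (fun i => by refine Fin.lastCases ?_ (fun j => ?_) i <;> simp [hc])
    (by simpa [Fin.sum_univ_castSucc] using hsum)
  funext i
  simpa using congrFun h0 i.castSucc

/-- The columns of the Moore matrix of a family independent over the fixed field are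
independent. -/
lemma FixedIndependent.moore_col {k : Type*} [Field k] {τ : RingAut k} {n : ℕ} {a : Fin n → k}
    (h : FixedIndependent τ a) (c : Fin n → k)
    (hc : ∀ l < n, ∑ i, c i * (τ ^ l) (a i) = 0) : c = 0 := by
  induction n with
  | zero => exact Subsingleton.elim _ _
  | succ n ih =>
    by_cases hlast : c (Fin.last n) = 0
    · have h0 := ih h.castSucc (fun i => c i.castSucc) fun l hl => by
        simpa [Fin.sum_univ_castSucc, hlast] using hc l (by omega)
      funext i
      refine Fin.lastCases (by simpa using hlast) (fun j => ?_) i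
      simpa using congrFun h0 j
    · obtain ⟨d, hd⟩ : ∃ d : Fin (n + 1) → k, d = fun i => (c (Fin.last n))⁻¹ * c i := ⟨_, rfl⟩
      have hd1 : d (Fin.last n) = 1 := by simp [hd, hlast]
      have hdsum : ∀ l < n + 1, ∑ i, d i * (τ ^ l) (a i) = 0 := fun l hl => by
        simp only [hd, mul_assoc, ← Finset.mul_sum, hc l hl, mul_zero]
      have he := ih h.castSucc (fun i => d i.castSucc - τ.symm (d i.castSucc)) fun l hl => by
        apply τ.injective
        have h1 := congrArg τ (hdsum l (by omega))
        have h2 := hdsum (l + 1) (by omega)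
        simp only [map_sum, map_mul, map_zero] at h1
        simp only [pow_succ', RingAut.mul_apply] at h2
        simp only [Fin.sum_univ_castSucc, hd1, map_one] at h1 h2
        simp only [map_sum, map_mul, map_sub, map_zero, RingEquiv.apply_symm_apply, sub_mul,
          Finset.sum_sub_distrib]
        linear_combination h1 - h2
      have hfix : ∀ i, τ (d i) = d i := by
        refine Fin.lastCases (by simp [hd1]) fun j => ?_
        have hj : d j.castSucc = τ.symm (d j.castSucc) := sub_eq_zero.mp (congrFun he j)
        conv_lhs => rw [hj]
        simp
      have h0 := h d hfix (by simpa using hdsum 0 (by omega))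
      simp [h0] at hd1

/-- The rows of the Moore matrix of a family independent over the fixed field are
independent. -/
lemma FixedIndependent.moore_row {k : Type*} [Field k] {τ : RingAut k} {n : ℕ} {a : Fin n → k}
    (h : FixedIndependent τ a) (c : Fin n → k)
    (hc : ∀ i, ∑ l : Fin n, c l * (τ ^ (l : ℕ)) (a i) = 0) : c = 0 := by
  let M : Matrix (Fin n) (Fin n) k := Matrix.of fun l i => (τ ^ (l : ℕ)) (a i)
  have hM : IsUnit M := by
    refine Matrix.mulVec_injective_iff_isUnit.mp
      ((injective_iff_map_eq_zero M.mulVecLin).mpr fun v hv => h.moore_col v fun l hl => ?_)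
    simpa [M, Matrix.mulVec, dotProduct, mul_comm] using congrFun hv ⟨l, hl⟩
  refine Matrix.vecMul_injective_iff_isUnit.mpr hM ?_
  funext i
  simpa [M, Matrix.vecMul, dotProduct] using hc i

/-- If `n` coordinates of `b` are independent over the fixed field of `τ`, then the first `n`
iterates of `b` under `τ` are linearly independent. -/
lemma FixedIndependent.linearIndependent_iterates {k ι : Type*} [Field k] {τ : RingAut k} {n : ℕ}
    {b : ι → k} {r : Fin n → ι} (h : FixedIndependent τ (fun j => b (r j))) :
    LinearIndependent k (fun (l : Fin n) (i : ι) => (τ ^ (l : ℕ)) (b i)) := by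
  rw [Fintype.linearIndependent_iff]
  intro c hc
  refine congrFun (h.moore_row c fun j => ?_)
  simpa using congrFun hc (r j)

/-- A `τ`-fixed vector in the span of `b, …, τ^(n-1) b` vanishes, provided that
`b, …, τ^n b` are linearly independent. -/
lemma eq_zero_of_fixed_of_mem_span {k ι : Type*} [Field k] {τ : RingAut k} {n : ℕ} {b : ι → k}
    (hb : LinearIndependent k (fun (l : Fin (n + 1)) (i : ι) => (τ ^ (l : ℕ)) (b i)))
    {w : ι → k} (hw : ∀ i, τ (w i) = w i)
    (hmem : w ∈ Submodule.span k
      (Set.range fun (l : Fin n) (i : ι) => (τ ^ (l : ℕ)) (b i))) : w = 0 := by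
  obtain ⟨c, rfl⟩ := (Submodule.mem_span_range_iff_exists_fun k).mp hmem
  rw [Fintype.linearIndependent_iff] at hb
  have hdiff := hb (fun l => (Fin.snoc c 0 : Fin (n + 1) → k) l
      - (Fin.cons 0 (fun j => τ (c j)) : Fin (n + 1) → k) l) <| by
    funext i
    have hi := hw i
    simp only [Finset.sum_apply, Pi.smul_apply, smul_eq_mul, map_sum, map_mul] at hi
    simp only [sub_smul, Finset.sum_sub_distrib, Pi.sub_apply, Finset.sum_apply, Pi.smul_apply,
      smul_eq_mul, Pi.zero_apply]
    rw [Fin.sum_univ_castSucc, Fin.sum_univ_succ (n := n)]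
    simp only [Fin.snoc_castSucc, Fin.snoc_last, Fin.cons_zero, Fin.cons_succ, Fin.val_castSucc,
      Fin.val_succ, pow_succ', RingAut.mul_apply, hi, zero_mul, add_zero, zero_add, sub_self]
  have hzero : ∀ i, (Fin.snoc c 0 : Fin (n + 1) → k) i = 0 := by
    intro i
    induction i using Fin.induction with
    | zero => simpa using hdiff 0
    | succ j hj =>
      have := hdiff j.succ
      simp only [Fin.snoc_castSucc] at hj
      simpa [hj] using this
  have hc : c = 0 := funext fun j => by simpa using hzero j.castSucc
  simp [hc]

/-- Two orthogonal linearly independent families in `k^ι` have at most `#ι` members in total. -/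
lemma LinearIndependent.card_add_card_le_of_dotProduct_eq_zero {k ι κ μ : Type*} [Field k]
    [Fintype ι] [Fintype κ] [Fintype μ] {x : κ → ι → k} {y : μ → ι → k}
    (hx : LinearIndependent k x) (hy : LinearIndependent k y)
    (hxy : ∀ s t, ∑ i, x s i * y t i = 0) :
    Fintype.card κ + Fintype.card μ ≤ Fintype.card ι := by
  have hmul : (Matrix.of x) * (Matrix.of y).transpose = 0 := by
    ext s t
    simpa [Matrix.mul_apply] using hxy s t
  have hX : (Matrix.of x).rank = Fintype.card κ := LinearIndependent.rank_matrix hx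
  have hY : (Matrix.of y).rank = Fintype.card μ := LinearIndependent.rank_matrix hy
  have := Matrix.rank_add_rank_le_card_of_mul_eq_zero hmul
  rwa [Matrix.rank_transpose, hX, hY] at this

/-- The signs in the Gram matrix of the form underlying the self-duality relations in odd
dimension `2 * n + 1`. -/
def middleSign (k : Type*) [Field k] (n i : ℕ) : k :=
  if i = n then -(-1) ^ (n + 1) else 1

lemma middleSign_ne_zero (k : Type*) [Field k] (n i : ℕ) : middleSign k n i ≠ 0 := by
  unfold middleSign
  split <;> simp

lemma map_middleSign {k : Type*} [Field k] (τ : RingAut k) (n i : ℕ) :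
    τ (middleSign k n i) = middleSign k n i := by
  unfold middleSign
  split <;> simp

lemma sum_Icc_one_eq_sum_fin {M : Type*} [AddCommMonoid M] (n : ℕ) (f : ℕ → M) :
    ∑ i ∈ Finset.Icc 1 n, f i = ∑ i : Fin n, f (i + 1) := by
  rw [Fin.sum_univ_eq_sum_range (fun i => f (i + 1)), Finset.range_eq_Ico, Finset.sum_Ico_add' f]
  rfl

/-- The form underlying the self-duality relations, split along its antidiagonal. -/
lemma sum_mul_middleSign_mul_rev {k : Type*} [Field k] (n : ℕ) (x y : ℕ → k) :
    ∑ i : Fin (2 * n + 1), x (i + 1) * (middleSign k n i * y (2 * n + 1 - i)) =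
      ∑ i ∈ Finset.Icc 1 n, (x (2 * n + 2 - i) * y i + y (2 * n + 2 - i) * x i)
        - (-1) ^ (n + 1) * x (n + 1) * y (n + 1) := by
  rw [Fin.sum_univ_eq_sum_range
    (fun i => x (i + 1) * (middleSign k n i * y (2 * n + 1 - i))),
    show 2 * n + 1 = (n + 1) + n by omega, Finset.sum_range_add, Finset.sum_range_succ,
    Finset.sum_add_distrib, sum_Icc_one_eq_sum_fin, sum_Icc_one_eq_sum_fin,
    Fin.sum_univ_eq_sum_range (fun i => x (2 * n + 2 - (i + 1)) * y (i + 1)),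
    Fin.sum_univ_eq_sum_range (fun i => y (2 * n + 2 - (i + 1)) * x (i + 1)),
    ← Finset.sum_range_reflect (fun i => x (2 * n + 2 - (i + 1)) * y (i + 1))]
  have h1 : ∀ i ∈ Finset.range n, x (i + 1) * (middleSign k n i * y (n + 1 + n - i)) =
      y (2 * n + 2 - (i + 1)) * x (i + 1) := fun i hi => by
    rw [Finset.mem_range] at hi
    rw [middleSign, if_neg hi.ne, show n + 1 + n - i = 2 * n + 2 - (i + 1) by omega]
    ring
  have h2 : ∀ i ∈ Finset.range n,
      x (n + 1 + i + 1) * (middleSign k n (n + 1 + i) * y (n + 1 + n - (n + 1 + i))) =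
      x (2 * n + 2 - (n - 1 - i + 1)) * y (n - 1 - i + 1) := fun i hi => by
    rw [Finset.mem_range] at hi
    rw [middleSign, if_neg (by omega), show n + 1 + n - (n + 1 + i) = n - 1 - i + 1 by omega,
      show 2 * n + 2 - (n - 1 - i + 1) = n + 1 + i + 1 by omega]
    ring
  rw [Finset.sum_congr rfl h1, Finset.sum_congr rfl h2, middleSign, if_pos rfl,
    show n + 1 + n - n = n + 1 by omega]
  ring

/-- The self-duality relations make the even and odd twists of the vector orthogonal. -/
lemma SelfDualRelations.sum_even_odd_eq_zero {p : ℕ} [Fact p.Prime] {k : Type*} [Field k]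
    [IsAlgClosed k] [CharP k p] {n : ℕ} {a : ℕ → k} (h : SelfDualRelations p (2 * n + 1) a)
    {s t : ℕ} (hs : s ≤ n) (ht : t < n) :
    ∑ i : Fin (2 * n + 1), ((frobeniusEquiv k p : RingAut k) ^ (2 * s)) (a (i + 1)) *
      (middleSign k n i *
        ((frobeniusEquiv k p : RingAut k) ^ (2 * t + 1)) (a (2 * n + 1 - i))) = 0 := by
  have hrel : ∀ j, j < 2 * n → Odd j →
      ∑ i ∈ Finset.Icc 1 n, (a (2 * n + 2 - i) * ((frobeniusEquiv k p : RingAut k) ^ j) (a i)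
          + ((frobeniusEquiv k p : RingAut k) ^ j) (a (2 * n + 2 - i)) * a i) =
        (-1) ^ (n + 1) * a (n + 1) * ((frobeniusEquiv k p : RingAut k) ^ j) (a (n + 1)) := by
    intro j hj hodd
    rw [SelfDualRelations, if_neg (by simp)] at h
    have := h j hodd.pos (by omega) hodd
    rwa [show (2 * n + 1 - 1) / 2 = n by omega, show (2 * n + 1 + 1) / 2 = n + 1 by omega] at this
  generalize (frobeniusEquiv k p : RingAut k) = φ at hrel ⊢
  rw [sum_mul_middleSign_mul_rev n (fun i => (φ ^ (2 * s)) (a i))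
    (fun i => (φ ^ (2 * t + 1)) (a i)), sub_eq_zero]
  rcases le_or_gt s t with hst | hst
  · have := congrArg (φ ^ (2 * s)) (hrel (2 * (t - s) + 1) (by omega) ⟨_, rfl⟩)
    simp only [map_sum, map_add, map_mul, ← RingAut.mul_apply, ← pow_add, map_pow, map_neg,
      map_one, show 2 * s + (2 * (t - s) + 1) = 2 * t + 1 by omega] at this
    rw [← this]
  · have := congrArg (φ ^ (2 * t + 1)) (hrel (2 * (s - t - 1) + 1) (by omega) ⟨_, rfl⟩)
    simp only [map_sum, map_add, map_mul, ← RingAut.mul_apply, ← pow_add, map_pow, map_neg,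
      map_one, show 2 * t + 1 + (2 * (s - t - 1) + 1) = 2 * s by omega] at this
    rw [mul_right_comm, ← this]
    exact Finset.sum_congr rfl fun i _ => by ring

/-- Let `g ≥ 3` be odd, `m = (g+1)/2`, and `a_1, …, a_g ∈ k`. If
`a_1, …, a_m` are linearly independent over `𝔽_{p²}` and `(a_1, …, a_g)` satisfies the
self-duality relations `R_g`, then `a_1, …, a_g` are linearly independent over `𝔽_{p²}`. -/
theorem stmt5 (p : ℕ) [Fact p.Prime] (k : Type*) [Field k] [IsAlgClosed k] [CharP k p]
    (g : ℕ) (hg : 3 ≤ g) (hgodd : Odd g) (a : ℕ → k)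
    (hindep : ∀ c : ℕ → k, (∀ i, c i ^ p ^ 2 = c i) →
      ∑ i ∈ Finset.Icc 1 ((g + 1) / 2), c i * a i = 0 →
      ∀ i ∈ Finset.Icc 1 ((g + 1) / 2), c i = 0)
    (hrel : SelfDualRelations p g a) :
    ∀ c : ℕ → k, (∀ i, c i ^ p ^ 2 = c i) →
      ∑ i ∈ Finset.Icc 1 g, c i * a i = 0 →
      ∀ i ∈ Finset.Icc 1 g, c i = 0 := by
  obtain ⟨n, rfl⟩ := hgodd
  obtain ⟨φ, hφ⟩ : ∃ φ : RingAut k, φ = frobeniusEquiv k p := ⟨_, rfl⟩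
  have hfix : ∀ x, (φ ^ 2) x = x ↔ x ^ p ^ 2 = x := fun x => by
    rw [hφ, pow_two, pow_two, pow_mul, RingAut.mul_apply]
    rfl
  have hfix_symm : ∀ x, (φ ^ 2) x = x → (φ ^ 2) (φ.symm x) = φ.symm x := fun x hx => by
    apply φ.injective
    calc φ ((φ ^ 2) (φ.symm x)) = (φ ^ 2) (φ (φ.symm x)) := rfl
      _ = φ (φ.symm x) := by simp [hx]
  have ha : FixedIndependent (φ ^ 2) (fun j : Fin (n + 1) => a (j + 1)) := by
    intro c hc hsum
    have h0 := hindep (fun i => c (Fin.ofNat (n + 1) (i - 1)))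
      (fun i => (hfix _).mp (hc _))
      (by
        rw [show (2 * n + 1 + 1) / 2 = n + 1 by omega, sum_Icc_one_eq_sum_fin]
        simpa using hsum)
    funext j
    simpa using h0 (j + 1) (Finset.mem_Icc.mpr (by omega))
  intro c hc hsum
  let b : Fin (2 * n + 1) → k := fun i => middleSign k n i * φ (a (2 * n + 1 - i))
  have hb_iter : ∀ (l : ℕ) (i : Fin (2 * n + 1)), ((φ ^ 2) ^ l) (b i) =
      middleSign k n i * (φ ^ (2 * l + 1)) (a (2 * n + 1 - i)) := fun l i => by
    rw [map_mul, map_middleSign, pow_succ φ (2 * l), pow_mul, RingAut.mul_apply]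
  have hb : FixedIndependent (φ ^ 2)
      (fun j : Fin (n + 1) => b ⟨2 * n - j, by omega⟩) := by
    intro d hd hdsum
    have h0 := ha (fun j => φ.symm (d j * middleSign k n (2 * n - j)))
      (fun j => hfix_symm _ (by rw [map_mul, map_middleSign, hd]))
      (by
        apply φ.injective
        rw [map_zero, ← hdsum, map_sum]
        refine Finset.sum_congr rfl fun j _ => ?_
        rw [map_mul, RingEquiv.apply_symm_apply, mul_assoc]
        simp only [b]
        rw [show 2 * n + 1 - (2 * n - (j : ℕ)) = j + 1 by omega])
    funext j
    have hj := congrFun h0 j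
    simpa [middleSign_ne_zero] using hj
  have hc_iter : ∀ l i : ℕ, ((φ ^ 2) ^ l) (c i) = c i := fun l i => by
    rw [RingAut.coe_pow]
    exact Function.iterate_fixed ((hfix _).mpr (hc _)) l
  have ha_ind := FixedIndependent.linearIndependent_iterates
    (b := fun i : Fin (2 * n + 1) => a (i + 1)) (r := Fin.castLE (by omega)) ha
  have hb_ind := hb.linearIndependent_iterates
  have hw : (fun i : Fin (2 * n + 1) => c (i + 1)) = 0 := by
    refine eq_zero_of_fixed_of_mem_span hb_ind (fun i => (hfix _).mpr (hc _)) ?_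
    by_contra hmem
    have hcons := linearIndependent_finCons.mpr
      ⟨hb_ind.comp _ (Fin.castSucc_injective n), hmem⟩
    have hcard := ha_ind.card_add_card_le_of_dotProduct_eq_zero hcons fun s t => by
      refine Fin.cases ?_ (fun l => ?_) t
      · rw [sum_Icc_one_eq_sum_fin] at hsum
        have := congrArg (fun x => ((φ ^ 2) ^ (s : ℕ)) x) hsum
        simp only [map_sum, map_mul, map_zero, hc_iter] at this
        simpa only [Fin.cons_zero, mul_comm] using this
      · have := hrel.sum_even_odd_eq_zero (Nat.lt_succ_iff.mp s.2) l.2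
        rw [← hφ] at this
        simpa only [Fin.cons_succ, Function.comp_apply, Fin.val_castSucc, hb_iter, pow_mul φ 2 s] using this
    simp at hcard
    omega
  intro i hi
  rw [Finset.mem_Icc] at hi
  simpa [Nat.sub_add_cancel hi.1] using congrFun hw ⟨i - 1, by omega⟩
end

section
/- Let x_1, x_2, x_3, x_4 ∈ k be linearly independent over 𝔽_{p²} and let ε_1, ε_2, ε_3, ε_4 ∈ 𝔽_{p²}. Let B be the 4×4 matrix over k whose i-th column is (x_i, σ²(x_i), σ⁴(x_i), ε_i)ᵀ. Then det B = 0 if and only if ε_1 = ε_2 = ε_3 = ε_4 = 0. -/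
open Finset

/-- Moore's criterion: if the `x i`, `i ∈ S`, are linearly independent over the fixed field of `τ`,
then the columns `(x i, τ (x i), τ² (x i), …)` of length `#S` are linearly independent. -/
theorem eq_zero_of_sum_mul_iterate_eq_zero {K ι : Type*} [Field K] [DecidableEq ι] (τ : RingAut K)
    (x : ι → K) (S : Finset ι)
    (hx : ∀ c : ι → K, (∀ i, τ (c i) = c i) → ∑ i ∈ S, c i * x i = 0 → ∀ i ∈ S, c i = 0)
    (w : ι → K) (hw : ∀ s < #S, ∑ i ∈ S, w i * (τ ^ s) (x i) = 0) : ∀ i ∈ S, w i = 0 := by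
  induction hn : #S generalizing S w with
  | zero => simp [card_eq_zero.mp hn]
  | succ n ih =>
    by_contra! ⟨j, hj, hwj⟩
    have hcard : #(S.erase j) = n := by rw [card_erase_of_mem hj, hn]; rfl
    set v : ι → K := fun i => w i / w j with hv
    have hvj : v j = 1 := div_self hwj
    have hsum : ∀ s < n + 1, ∑ i ∈ S, v i * (τ ^ s) (x i) = 0 := by
      intro s hs
      have h := hw s (hn ▸ hs)
      simp only [hv, div_mul_eq_mul_div, ← sum_div, h, zero_div]
    have hsymm : ∀ s < n, ∑ i ∈ S, τ.symm (v i) * (τ ^ s) (x i) = 0 := by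
      intro s hs
      have h := congrArg τ.symm (hsum (s + 1) (by lia))
      simpa [pow_succ'] using h
    have hfix : ∀ i ∈ S, τ (v i) = v i := by
      have h := ih (S.erase j) ?_ (fun i => v i - τ.symm (v i)) ?_ hcard
      · intro i hi
        by_cases hij : i = j
        · rw [hij, hvj, map_one]
        · have h' := sub_eq_zero.mp (h i (mem_erase.mpr ⟨hij, hi⟩))
          exact (τ.symm_apply_eq.mp h'.symm).symm
      · intro c hc h0 i hi
        have h := hx (fun i => if i = j then 0 else c i) (fun i => by split_ifs <;> simp [hc]) ?_ i
          (mem_of_mem_erase hi)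
        · simpa [ne_of_mem_erase hi] using h
        · rw [← add_sum_erase _ _ hj, if_pos rfl, zero_mul, zero_add, ← h0]
          exact sum_congr rfl fun i hi => by rw [if_neg (ne_of_mem_erase hi)]
      · intro s hs
        rw [hcard] at hs
        rw [sum_erase _ (by simp [hvj])]
        simp only [sub_mul, sum_sub_distrib, hsum s (by lia), hsymm s hs, sub_zero]
    have h := hx (fun i => if i ∈ S then v i else 0) (fun i => ?_) ?_ j hj
    · simp [hj, hvj] at h
    · split_ifs with hi
      · exact hfix i hi
      · exact map_zero τ
    · simpa [sum_ite_mem] using hsum 0 (by lia)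

/-- If the `x i` are linearly independent over the fixed field of `τ` and the `ε i` are fixed by `τ`
and not all zero, then a vector orthogonal to `ε` and to the first `#ι - 1` iterates of `x` under `τ`
vanishes. -/
theorem eq_zero_of_sum_mul_iterate_eq_zero_of_fixed {K ι : Type*} [Field K] [Fintype ι]
    [DecidableEq ι] (τ : RingAut K) (x : ι → K)
    (hx : ∀ c : ι → K, (∀ i, τ (c i) = c i) → ∑ i, c i * x i = 0 → ∀ i, c i = 0)
    (ε : ι → K) (hε : ∀ i, τ (ε i) = ε i) {j : ι} (hj : ε j ≠ 0) (w : ι → K)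
    (hw : ∀ s < Fintype.card ι - 1, ∑ i, w i * (τ ^ s) (x i) = 0) (hwε : ∑ i, w i * ε i = 0) :
    w = 0 := by
  have hpow : ∀ (s : ℕ) i, (τ ^ s) (ε i) = ε i := by
    intro s i
    induction s with
    | zero => rfl
    | succ s ih => rw [pow_succ', RingAut.mul_apply, ih, hε]
  have h := eq_zero_of_sum_mul_iterate_eq_zero τ (fun i => x i - ε i / ε j * x j) (univ.erase j)
    ?_ w ?_
  · have h' : ∀ i, i ≠ j → w i = 0 := fun i hi => h i (by simp [hi])
    have hwj : w j = 0 := by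
      rw [sum_eq_single j (fun i _ hi => by rw [h' i hi, zero_mul]) (by simp)] at hwε
      exact (mul_eq_zero.mp hwε).resolve_right hj
    funext i
    by_cases hi : i = j
    · rw [hi, hwj]; rfl
    · exact h' i hi
  · intro c hc h0 i hi
    have h := hx (fun i => if i = j then -∑ l ∈ univ.erase j, c l * (ε l / ε j) else c i)
      (fun i => by split_ifs <;> simp [hc, hε]) ?_ i
    · simpa [ne_of_mem_erase hi] using h
    · have hrest : ∀ d : K, ∑ i ∈ univ.erase j, (if i = j then d else c i) * x i =
          ∑ i ∈ univ.erase j, c i * x i :=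
        fun d => sum_congr rfl fun i hi => by rw [if_neg (ne_of_mem_erase hi)]
      rw [← add_sum_erase _ _ (mem_univ j), if_pos rfl, hrest, ← h0]
      simp only [mul_sub, sum_sub_distrib, neg_mul, sum_mul, mul_assoc]
      ring
  · intro s hs
    rw [card_erase_of_mem (mem_univ j), card_univ] at hs
    rw [sum_erase _ (by simp [hj])]
    have hterm : ∀ i, w i * (τ ^ s) (x i - ε i / ε j * x j) =
        w i * (τ ^ s) (x i) - w i * ε i * ((τ ^ s) (x j) / ε j) := by
      intro i
      rw [map_sub, map_mul, map_div₀, hpow, hpow]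
      ring
    simp only [hterm, sum_sub_distrib, ← sum_mul, hw s hs, hwε, zero_mul, sub_zero]

/-- Let `x_1, x_2, x_3, x_4 ∈ k` be linearly independent over `𝔽_{p²}` and
`ε_1, …, ε_4 ∈ 𝔽_{p²}`. Let `B` be the `4×4` matrix whose `i`-th column is
`(x_i, σ²(x_i), σ⁴(x_i), ε_i)ᵀ`. Then `det B = 0` iff all `ε_i = 0`. -/
theorem stmt6 (p : ℕ) [Fact p.Prime] (k : Type*) [Field k] [IsAlgClosed k] [CharP k p]
    (x : Fin 4 → k)
    (hx : ∀ c : Fin 4 → k, (∀ i, c i ^ p ^ 2 = c i) → ∑ i, c i * x i = 0 → ∀ i, c i = 0)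
    (ε : Fin 4 → k) (hε : ∀ i, ε i ^ p ^ 2 = ε i) :
    (Matrix.of fun (r c : Fin 4) =>
        ![x c, ((frobeniusEquiv k p : RingAut k) ^ 2) (x c),
          ((frobeniusEquiv k p : RingAut k) ^ 4) (x c), ε c] r).det = 0
      ↔ ∀ i, ε i = 0 := by
  set τ : RingAut k := (frobeniusEquiv k p : RingAut k) ^ 2 with hτ
  have hτ4 : (frobeniusEquiv k p : RingAut k) ^ 4 = τ ^ 2 := by rw [hτ, ← pow_mul]
  have hτp : ∀ a, τ a = a ^ p ^ 2 := by
    intro a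
    rw [hτ, pow_two, RingAut.mul_apply, frobeniusEquiv_apply, frobeniusEquiv_apply, frobenius_def,
      frobenius_def, ← pow_mul, pow_two]
  constructor
  · intro hdet
    by_contra! ⟨j, hj⟩
    obtain ⟨w, hw0, hw⟩ := Matrix.exists_mulVec_eq_zero_iff.mpr hdet
    refine hw0 (eq_zero_of_sum_mul_iterate_eq_zero_of_fixed τ x (fun c hc => hx c fun i => ?_) ε
      (fun i => ?_) hj w (fun s hs => ?_) ?_)
    · rw [← hτp, hc]
    · rw [hτp, hε]
    · rw [Fintype.card_fin] at hs
      interval_cases s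
      · simpa [Matrix.mulVec, dotProduct, mul_comm] using congrFun hw 0
      · simpa [Matrix.mulVec, dotProduct, mul_comm] using congrFun hw 1
      · simpa [Matrix.mulVec, dotProduct, mul_comm, hτ4] using congrFun hw 2
    · simpa [Matrix.mulVec, dotProduct, mul_comm] using congrFun hw 3
  · intro h
    exact Matrix.det_eq_zero_of_row_eq_zero 3 fun c => by simp [h]
end
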